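/- arXiv:2106.09688 — 3 statements merged into one kernel-verified Lean document; each statement's English description precedes it below -/
import Mathlib

section
/- Given any constant γ > 0 and integers k, t, C ∈ ℕ with k ≥ 3, there exists ξ > 0 such that the following holds for all sufficiently large n ∈ ℕ. Let F be a k-vertex graph and G be an n-vertex graph with a partition {V_1, …, V_C} of V(G) such that for each i ∈ [C]: (1) for every vertex v ∈ V_i there is an F-fan at v in V_i of size at least γn; and (2) every k-element subset S ⊆ V_i has at least γn pairwise vertex-disjoint (F,t)-absorbers in G. Then G contains pairwise disjoint subsets A_1, …, A_C of V(G), each of size at most (γ/C)n, such that, setting R = A_1 ∪ ⋯ ∪ A_C, for each i ∈ [C] the set A_i is a ξ-absorbing set with respect to V_i ∖ R. -/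
open Finset

namespace RTT

variable {k n : ℕ}

/-- `S` spans a copy of the `k`-vertex graph `F` in `G`:
there is an injective graph homomorphism from `F` to `G` with image exactly `S`. -/
def SpansCopy (F : SimpleGraph (Fin k)) (G : SimpleGraph (Fin n))
    (S : Finset (Fin n)) : Prop :=
  ∃ f : Fin k → Fin n, Function.Injective f ∧
    (∀ a b, F.Adj a b → G.Adj (f a) (f b)) ∧ Finset.image f Finset.univ = S

/-- `T` is an `F`-tiling in `G`: a collection of pairwise vertex-disjoint vertex sets,
each spanning a copy of `F`. -/
def IsTiling (F : SimpleGraph (Fin k)) (G : SimpleGraph (Fin n))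
    (T : Finset (Finset (Fin n))) : Prop :=
  (∀ S ∈ T, SpansCopy F G S) ∧ ∀ S ∈ T, ∀ S' ∈ T, S ≠ S' → Disjoint S S'

/-- The induced subgraph of `G` on the vertex set `A` has a perfect `F`-tiling. -/
def PerfTilingOn (F : SimpleGraph (Fin k)) (G : SimpleGraph (Fin n))
    (A : Finset (Fin n)) : Prop :=
  ∃ T : Finset (Finset (Fin n)), IsTiling F G T ∧ T.biUnion id = A

/-- The minimum degree of `G` is at least `x`. -/
def MinDegGE (G : SimpleGraph (Fin n)) (x : ℝ) : Prop :=
  ∀ v : Fin n, x ≤ ((G.neighborSet v).ncard : ℝ)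

/-- The `r`-independence number of `G` is at most `x`: every vertex set whose induced
subgraph contains no copy of `K_r` has size at most `x`. -/
def IndepBound (G : SimpleGraph (Fin n)) (r : ℕ) (x : ℝ) : Prop :=
  ∀ S : Finset (Fin n), (∀ T ⊆ S, ¬ G.IsNClique r T) → (S.card : ℝ) ≤ x

/-- `α*(G) ≤ x`: every bipartite hole of `G` has size at most `x`. -/
def HoleBound (G : SimpleGraph (Fin n)) (x : ℝ) : Prop :=
  ∀ (s : ℕ) (U₁ U₂ : Finset (Fin n)), Disjoint U₁ U₂ → U₁.card = s → U₂.card = s →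
    (∀ u ∈ U₁, ∀ v ∈ U₂, ¬ G.Adj u v) → (s : ℝ) ≤ x

/-- `A` is a `ξ`-absorbing set with respect to `V'` (for the `k`-vertex graph `F`
in the `n`-vertex graph `G`). -/
def IsAbsorbingSet (F : SimpleGraph (Fin k)) (G : SimpleGraph (Fin n)) (ξ : ℝ)
    (V' A : Finset (Fin n)) : Prop :=
  ∀ U : Finset (Fin n), U ⊆ V' \ A → (U.card : ℝ) ≤ ξ * n →
    k ∣ (A ∪ U).card → PerfTilingOn F G (A ∪ U)

/-- `A` is an `(F,t)`-absorber for the `k`-set `S`. -/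
def IsAbsorber (F : SimpleGraph (Fin k)) (G : SimpleGraph (Fin n)) (t : ℕ)
    (S A : Finset (Fin n)) : Prop :=
  Disjoint A S ∧ A.card ≤ k ^ 2 * t ∧ PerfTilingOn F G A ∧ PerfTilingOn F G (A ∪ S)

/-- `S` has a family of at least `x` pairwise vertex-disjoint `(F,t)`-absorbers in `G`. -/
def HasManyAbsorbers (F : SimpleGraph (Fin k)) (G : SimpleGraph (Fin n)) (t : ℕ)
    (S : Finset (Fin n)) (x : ℝ) : Prop :=
  ∃ 𝒜 : Finset (Finset (Fin n)), x ≤ (𝒜.card : ℝ) ∧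
    (∀ A ∈ 𝒜, IsAbsorber F G t S A) ∧
    ∀ A ∈ 𝒜, ∀ A' ∈ 𝒜, A ≠ A' → Disjoint A A'

/-- `𝒮` is an `F`-fan at `v` in `U`: a collection of pairwise disjoint `(k-1)`-sets
`S ⊆ U \ {v}` such that `{v} ∪ S` spans a copy of `F`; its size is `𝒮.card`. -/
def IsFan (F : SimpleGraph (Fin k)) (G : SimpleGraph (Fin n)) (v : Fin n)
    (U : Finset (Fin n)) (𝒮 : Finset (Finset (Fin n))) : Prop :=
  (∀ S ∈ 𝒮, S ⊆ U.erase v ∧ S.card = k - 1 ∧ SpansCopy F G (insert v S)) ∧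
    ∀ S ∈ 𝒮, ∀ S' ∈ 𝒮, S ≠ S' → Disjoint S S'

/-- `u` and `v` are `(F, m, t)`-reachable in `G`. -/
def FReachable (F : SimpleGraph (Fin k)) (G : SimpleGraph (Fin n)) (m : ℝ) (t : ℕ)
    (u v : Fin n) : Prop :=
  ∀ W : Finset (Fin n), (W.card : ℝ) ≤ m →
    ∃ S : Finset (Fin n), Disjoint S W ∧ u ∉ S ∧ v ∉ S ∧ S.card ≤ k * t - 1 ∧
      PerfTilingOn F G (insert u S) ∧ PerfTilingOn F G (insert v S)

/-- `U` is `(F, m, t)`-closed in `G`. -/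
def FClosed (F : SimpleGraph (Fin k)) (G : SimpleGraph (Fin n)) (m : ℝ) (t : ℕ)
    (U : Finset (Fin n)) : Prop :=
  ∀ u ∈ U, ∀ v ∈ U, u ≠ v → FReachable F G m t u v

/-- `P` is a partition of the vertex set of an `n`-vertex graph into `C` parts. -/
def IsPartition {C : ℕ} (P : Fin C → Finset (Fin n)) : Prop :=
  (∀ i j, i ≠ j → Disjoint (P i) (P j)) ∧ Finset.univ.biUnion P = Finset.univ

/-- The `k`-vector `v` is `(F, β)`-robust with respect to the partition `P`:
it has coordinate sum `k`, and avoiding any set `W` of at most `βn` vertices there is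
a copy of `F` whose vertex set has index vector `v`. -/
def RobustVec (F : SimpleGraph (Fin k)) (G : SimpleGraph (Fin n)) {C : ℕ}
    (P : Fin C → Finset (Fin n)) (β : ℝ) (v : Fin C → ℕ) : Prop :=
  (∑ i, v i) = k ∧
    ∀ W : Finset (Fin n), (W.card : ℝ) ≤ β * n →
      ∃ S : Finset (Fin n), Disjoint S W ∧ SpansCopy F G S ∧ ∀ i, (S ∩ P i).card = v i

end RTT

namespace RTT

lemma sum_ind (n L : ℕ) (T : Finset (Fin n)) :
    ∑ φ : Fin n → Fin (L+1), (if ∀ x ∈ T, φ x = 0 then (1:ℝ) else 0)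
      = ((L:ℝ)+1)^n * (1/((L:ℝ)+1))^T.card := by
  classical
  have h1 : ∀ φ : Fin n → Fin (L+1), (if ∀ x ∈ T, φ x = 0 then (1:ℝ) else 0)
      = ∏ x, (if x ∈ T → φ x = 0 then (1:ℝ) else 0) := by
    intro φ
    rw [Finset.prod_ite_zero]
    simp
  simp_rw [h1]
  have h2 := Finset.prod_univ_sum (fun _ : Fin n => (Finset.univ : Finset (Fin (L+1))))
    (fun x c => if x ∈ T → c = 0 then (1:ℝ) else 0)
  rw [Fintype.piFinset_univ] at h2
  rw [← h2]
  have h3 : ∀ x : Fin n, ∑ c : Fin (L+1), (if x ∈ T → c = 0 then (1:ℝ) else 0)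
      = ((L:ℝ)+1) * (if x ∈ T then 1/((L:ℝ)+1) else 1) := by
    intro x
    have : (L:ℝ)+1 ≠ 0 := by positivity
    by_cases hx : x ∈ T
    · simp [hx, this]
    · simp [hx]
  simp_rw [h3]
  rw [Finset.prod_mul_distrib]
  simp

lemma sum_half (n L m : ℕ) (𝒮 : Finset (Finset (Fin n)))
    (hc : ∀ S ∈ 𝒮, S.card = m) (hd : ∀ S ∈ 𝒮, ∀ S' ∈ 𝒮, S ≠ S' → Disjoint S S') :
    ∑ φ : Fin n → Fin (L+1),
      (1/2:ℝ)^(𝒮.filter (fun S => ∀ x ∈ S, φ x = 0)).card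
      = ((L:ℝ)+1)^n * (1 - (1/((L:ℝ)+1))^m / 2)^𝒮.card := by
  classical
  have h1 : ∀ φ : Fin n → Fin (L+1),
      (1/2:ℝ)^(𝒮.filter (fun S => ∀ x ∈ S, φ x = 0)).card
      = ∏ S ∈ 𝒮, (1 + (-1/2) * (if ∀ x ∈ S, φ x = 0 then (1:ℝ) else 0)) := by
    intro φ
    rw [← Finset.prod_const, Finset.prod_filter]
    refine Finset.prod_congr rfl fun S _ => ?_
    split_ifs <;> norm_num
  simp_rw [h1, Finset.prod_one_add]
  rw [Finset.sum_comm]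
  have h2 : ∀ 𝒯 ∈ 𝒮.powerset, ∑ φ : Fin n → Fin (L+1),
      ∏ S ∈ 𝒯, ((-1/2) * (if ∀ x ∈ S, φ x = 0 then (1:ℝ) else 0))
      = ((L:ℝ)+1)^n * ∏ S ∈ 𝒯, (- (1/((L:ℝ)+1))^m / 2) := by
    intro 𝒯 h𝒯
    rw [Finset.mem_powerset] at h𝒯
    have h3 : ∀ φ : Fin n → Fin (L+1),
        ∏ S ∈ 𝒯, ((-1/2) * (if ∀ x ∈ S, φ x = 0 then (1:ℝ) else 0))
        = (-1/2)^𝒯.card * (if ∀ x ∈ 𝒯.biUnion id, φ x = 0 then (1:ℝ) else 0) := by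
      intro φ
      rw [Finset.prod_mul_distrib, Finset.prod_const, Finset.prod_ite_zero]
      congr 1
      simp only [Finset.mem_biUnion, id, Finset.prod_const_one]
      congr 1
      apply propext
      constructor
      · rintro h x ⟨S, hS, hx⟩; exact h S hS x hx
      · intro h S hS x hx; exact h x ⟨S, hS, hx⟩
    simp_rw [h3]
    rw [← Finset.mul_sum, sum_ind]
    have h4 : (𝒯.biUnion id).card = m * 𝒯.card := by
      rw [Finset.card_biUnion]
      · simp only [id]
        rw [Finset.sum_congr rfl (fun S hS => hc S (h𝒯 hS))]
        simp [mul_comm]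
      · intro S hS S' hS' h; exact hd S (h𝒯 hS) S' (h𝒯 hS') h
    rw [h4, Finset.prod_const, pow_mul]
    rw [show (- (1/((L:ℝ)+1))^m / 2) = (-1/2) * (1/((L:ℝ)+1))^m by ring, mul_pow]
    ring
  rw [Finset.sum_congr rfl h2, ← Finset.mul_sum, ← Finset.prod_one_add, Finset.prod_const]
  congr 2
  ring

lemma exists_X (γ : ℝ) (hγ : 0 < γ) (m L : ℕ) :
    ∃ μ : ℝ, 0 < μ ∧ ∃ N : ℕ, 1 ≤ N ∧ ∀ n : ℕ, N ≤ n →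
      ∀ fan : Fin n → Finset (Finset (Fin n)),
      (∀ v, ∀ S ∈ fan v, S.card = m) →
      (∀ v, ∀ S ∈ fan v, ∀ S' ∈ fan v, S ≠ S' → Disjoint S S') →
      (∀ v, γ * n ≤ ((fan v).card : ℝ)) →
      ∃ X : Finset (Fin n), (X.card : ℝ) * (L+1) < 2 * n ∧
        ∀ v, μ * n < (((fan v).filter (fun S => S ⊆ X)).card : ℝ) := by
  classical
  set c : ℝ := 1 - (1/((L:ℝ)+1))^m / 2 with hcdef
  have hq0 : 0 < (1/((L:ℝ)+1))^m := by positivity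
  have hq1 : (1/((L:ℝ)+1))^m ≤ 1 := by
    apply pow_le_one₀ (by positivity)
    rw [div_le_one (by positivity)]
    linarith [(Nat.cast_nonneg L : (0:ℝ) ≤ L)]
  have hc0 : 0 < c := by rw [hcdef]; linarith
  have hc1 : c < 1 := by rw [hcdef]; linarith
  have hl2 : 0 < Real.log 2 := Real.log_pos (by norm_num)
  have hlc : Real.log c < 0 := Real.log_neg hc0 hc1
  set μ : ℝ := γ * (-Real.log c) / (2 * Real.log 2) with hμdef
  have hμ : 0 < μ := by
    rw [hμdef]; apply div_pos <;> [apply mul_pos hγ (by linarith); linarith]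
  set r : ℝ := Real.exp (γ * Real.log c / 2) with hr
  have hr1 : r < 1 := by
    rw [hr, Real.exp_lt_one_iff]
    have := mul_neg_of_pos_of_neg hγ hlc
    linarith
  have hr0 : 0 ≤ r := (Real.exp_pos _).le
  have ht := tendsto_self_mul_const_pow_of_lt_one hr0 hr1
  have hev := ht.eventually (gt_mem_nhds (show (0:ℝ) < 1/2 by norm_num))
  obtain ⟨N, hN⟩ := Filter.eventually_atTop.1 hev
  refine ⟨μ, hμ, max N 1, le_max_right _ _, ?_⟩
  intro n hn fan hc hd hs
  have hnN := hN n (le_trans (le_max_left _ _) hn)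
  have hn1 : 1 ≤ n := le_trans (le_max_right _ _) hn
  have hnpos : (0:ℝ) < n := by exact_mod_cast hn1
  have hLpos : (0:ℝ) < (L:ℝ)+1 := by positivity
  set E : ℝ := Real.exp (μ * n * Real.log 2) with hE
  let X : (Fin n → Fin (L+1)) → Finset (Fin n) := fun φ => Finset.univ.filter (fun x => φ x = 0)
  let g : (Fin n → Fin (L+1)) → ℝ := fun φ =>
    ((X φ).card : ℝ) * (((L:ℝ)+1) / (2 * n)) +
      ∑ v, E * (1/2:ℝ)^((fan v).filter (fun S => ∀ x ∈ S, φ x = 0)).card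
  have hsum1 : ∑ φ : Fin n → Fin (L+1), ((X φ).card : ℝ) = n * (((L:ℝ)+1)^n * (1/((L:ℝ)+1))) := by
    have : ∀ φ : Fin n → Fin (L+1), ((X φ).card : ℝ)
        = ∑ v, (if ∀ x ∈ ({v} : Finset (Fin n)), φ x = 0 then (1:ℝ) else 0) := by
      intro φ; simp [X]
    simp_rw [this]
    rw [Finset.sum_comm]
    simp_rw [sum_ind]
    simp
  have hEc : ∀ v, E * c^(fan v).card ≤ r^n := by
    intro v
    have h1 : c^(fan v).card = Real.exp ((fan v).card * Real.log c) := by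
      rw [Real.exp_nat_mul, Real.exp_log hc0]
    rw [h1, hE, hr, ← Real.exp_add, ← Real.exp_nat_mul]
    apply Real.exp_le_exp.2
    have h2 : μ * n * Real.log 2 = - (γ * n * Real.log c) / 2 := by
      rw [hμdef]; field_simp
    have h3 : ((fan v).card:ℝ) * Real.log c ≤ γ * n * Real.log c :=
      mul_le_mul_of_nonpos_right (hs v) hlc.le
    rw [h2]; linarith
  have hsum : ∑ φ, g φ < ∑ φ : Fin n → Fin (L+1), (1:ℝ) := by
    have : ∑ φ : Fin n → Fin (L+1), (1:ℝ) = ((L:ℝ)+1)^n := by simp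
    rw [this]
    simp only [g]
    rw [Finset.sum_add_distrib, ← Finset.sum_mul, hsum1, Finset.sum_comm]
    simp_rw [← Finset.mul_sum]
    have h5 : ∀ v, E * ∑ φ : Fin n → Fin (L+1),
        (1/2:ℝ)^((fan v).filter (fun S => ∀ x ∈ S, φ x = 0)).card ≤ ((L:ℝ)+1)^n * r^n := by
      intro v
      rw [sum_half n L m (fan v) (hc v) (hd v), mul_left_comm]
      exact mul_le_mul_of_nonneg_left (hEc v) (by positivity)
    have h6 := Finset.sum_le_sum (fun v (_ : v ∈ (Finset.univ : Finset (Fin n))) => h5 v)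
    simp only [Finset.sum_const, Finset.card_univ, Fintype.card_fin, nsmul_eq_mul] at h6
    rw [← Finset.mul_sum] at h6
    have h7 : (n:ℝ) * (((L:ℝ)+1)^n * (1/((L:ℝ)+1))) * (((L:ℝ)+1) / (2 * n)) = ((L:ℝ)+1)^n / 2 := by
      field_simp
    rw [h7]
    have h8 : (0:ℝ) < ((L:ℝ)+1)^n := by positivity
    have h9 : (n:ℝ) * (((L:ℝ)+1)^n * r^n) = ((L:ℝ)+1)^n * (n * r^n) := by ring
    rw [h9] at h6
    have h10 := mul_lt_mul_of_pos_left hnN h8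
    linarith
  obtain ⟨φ, -, hφ⟩ := Finset.exists_lt_of_sum_lt hsum
  have hEpos : 0 < E := Real.exp_pos _
  have hnn : ∀ v, 0 ≤ E * (1/2:ℝ)^((fan v).filter (fun S => ∀ x ∈ S, φ x = 0)).card :=
    fun v => by positivity
  refine ⟨X φ, ?_, ?_⟩
  · have h1 : ((X φ).card : ℝ) * (((L:ℝ)+1) / (2 * n)) < 1 := by
      have := Finset.sum_nonneg (fun v (_ : v ∈ (Finset.univ : Finset (Fin n))) => hnn v)
      simp only [g] at hφ
      linarith
    rw [← mul_div_assoc, div_lt_one (by positivity)] at h1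
    exact h1
  · intro v
    have h0 : (fan v).filter (fun S => S ⊆ X φ) = (fan v).filter (fun S => ∀ x ∈ S, φ x = 0) := by
      apply Finset.filter_congr
      intro S _
      simp [X, Finset.subset_iff]
    rw [h0]
    set s := ((fan v).filter (fun S => ∀ x ∈ S, φ x = 0)).card with hsdef
    have h1 : E * (1/2:ℝ)^s < 1 := by
      have h2 := Finset.single_le_sum (fun v (_ : v ∈ (Finset.univ : Finset (Fin n))) => hnn v)
        (Finset.mem_univ v)
      have h3 : 0 ≤ ((X φ).card : ℝ) * (((L:ℝ)+1) / (2 * n)) := by positivity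
      simp only [g] at hφ
      simp only [← hsdef] at h2
      linarith
    have h2 : (1/2:ℝ)^s = Real.exp (- (s * Real.log 2)) := by
      rw [Real.exp_neg, Real.exp_nat_mul, Real.exp_log (by norm_num)]
      simp
    rw [h2, hE, ← Real.exp_add, Real.exp_lt_one_iff] at h1
    by_contra hcon
    push Not at hcon
    have := mul_le_mul_of_nonneg_right hcon hl2.le
    linarith

end RTT
namespace RTT

lemma exists_disj {α : Type*} [DecidableEq α] (𝒜 : Finset (Finset α)) (W : Finset α)
    (hd : ∀ A ∈ 𝒜, ∀ A' ∈ 𝒜, A ≠ A' → Disjoint A A') (h : W.card < 𝒜.card) :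
    ∃ A ∈ 𝒜, Disjoint A W := by
  by_contra hcon
  push Not at hcon
  have h1 : ∀ A : Finset α, ∃ x, A ∈ 𝒜 → x ∈ A ∧ x ∈ W := by
    intro A
    by_cases hA : A ∈ 𝒜
    · obtain ⟨x, hx, hx'⟩ := Finset.not_disjoint_iff.1 (hcon A hA)
      exact ⟨x, fun _ => ⟨hx, hx'⟩⟩
    · obtain ⟨B, hB⟩ : 𝒜.Nonempty := Finset.card_pos.1 (by omega)
      obtain ⟨x, hx, hx'⟩ := Finset.not_disjoint_iff.1 (hcon B hB)
      exact ⟨x, fun h => absurd h hA⟩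
  choose f hf using h1
  have : 𝒜.card ≤ W.card := by
    apply Finset.card_le_card_of_injOn f (fun A hA => (hf A hA).2)
    intro A hA B hB hAB
    by_contra hne
    exact Finset.disjoint_left.1 (hd A hA B hB hne) (hf A hA).1 (hAB ▸ (hf B hB).1)
  omega

lemma greedy {ι α : Type*} [DecidableEq ι] [DecidableEq α] (cl : Finset α → Finset α)
    (𝒜 : ι → Finset (Finset α)) (W : Finset α) (c : ℕ) (J : Finset ι)
    (hcl : ∀ i ∈ J, ∀ j ∈ J, ∀ A ∈ 𝒜 i, ∀ B ∈ 𝒜 j, Disjoint A (cl B) → Disjoint B (cl A))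
    (hd : ∀ j ∈ J, ∀ A ∈ 𝒜 j, ∀ A' ∈ 𝒜 j, A ≠ A' → Disjoint A A')
    (hc : ∀ j ∈ J, ∀ A ∈ 𝒜 j, (cl A).card ≤ c)
    (h : ∀ j ∈ J, W.card + c * J.card < (𝒜 j).card) :
    ∃ g : ι → Finset α, ∀ j ∈ J, g j ∈ 𝒜 j ∧ Disjoint (g j) W ∧
      ∀ j' ∈ J, j ≠ j' → Disjoint (g j) (cl (g j')) := by
  induction J using Finset.induction_on with
  | empty => exact ⟨fun _ => ∅, by simp⟩
  | insert a J ha ih =>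
    rw [Finset.card_insert_of_notMem ha] at h
    obtain ⟨g, hg⟩ := ih (fun i hi j hj => hcl i (Finset.mem_insert_of_mem hi) j (Finset.mem_insert_of_mem hj))
      (fun j hj => hd j (Finset.mem_insert_of_mem hj))
      (fun j hj => hc j (Finset.mem_insert_of_mem hj))
      (fun j hj => by have := h j (Finset.mem_insert_of_mem hj); rw [mul_add] at this; omega)
    have hU : (J.biUnion (fun j => cl (g j))).card ≤ c * J.card := by
      rw [mul_comm]
      exact Finset.card_biUnion_le_card_mul _ _ _
        (fun j hj => hc j (Finset.mem_insert_of_mem hj) _ (hg j hj).1)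
    obtain ⟨A, hA, hAW⟩ := exists_disj (𝒜 a) (W ∪ J.biUnion (fun j => cl (g j)))
      (hd a (Finset.mem_insert_self _ _)) (by
        have := h a (Finset.mem_insert_self _ _)
        have h2 := Finset.card_union_le W (J.biUnion (fun j => cl (g j)))
        rw [mul_add] at this; omega)
    rw [Finset.disjoint_union_right, Finset.disjoint_biUnion_right] at hAW
    have hne : ∀ j ∈ J, j ≠ a := fun j hj h => ha (h ▸ hj)
    refine ⟨Function.update g a A, ?_⟩
    intro j hj
    rcases Finset.mem_insert.1 hj with rfl | hjJ
    · rw [Function.update_self]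
      refine ⟨hA, hAW.1, ?_⟩
      intro j' hj' hjj
      rcases Finset.mem_insert.1 hj' with rfl | hj'
      · exact absurd rfl hjj
      · rw [Function.update_of_ne (hne j' hj')]
        exact hAW.2 j' hj'
    · rw [Function.update_of_ne (hne j hjJ)]
      refine ⟨(hg j hjJ).1, (hg j hjJ).2.1, ?_⟩
      intro j' hj' hjj
      rcases Finset.mem_insert.1 hj' with rfl | hj'J
      · rw [Function.update_self]
        exact hcl _ hj' _ hj _ hA _ (hg j hjJ).1 (hAW.2 j hjJ)
      · rw [Function.update_of_ne (hne j' hj'J)]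
        exact (hg j hjJ).2.2 j' hj'J hjj

lemma initial_seg {α : Type*} [DecidableEq α] (rk : α → ℕ) (R : Finset α)
    (hinj : Set.InjOn rk R) (j : ℕ) (hj : j ≤ R.card) :
    ∃ D ⊆ R, D.card = j ∧ ∀ d ∈ D, ∀ r ∈ R \ D, rk d < rk r := by
  induction j with
  | zero => exact ⟨∅, by simp, by simp, by simp⟩
  | succ j ih =>
    obtain ⟨D, hD, hc, hlt⟩ := ih (by omega)
    have hne : (R \ D).Nonempty := by
      rw [← Finset.card_pos, Finset.card_sdiff_of_subset hD]; omega
    obtain ⟨a, ha, hmin⟩ := Finset.exists_min_image (R \ D) rk hne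
    have ha' := Finset.mem_sdiff.1 ha
    refine ⟨insert a D, Finset.insert_subset ha'.1 hD, by
      rw [Finset.card_insert_of_notMem ha'.2, hc], ?_⟩
    intro d hd r hr
    rw [Finset.mem_sdiff, Finset.mem_insert, not_or] at hr
    rcases Finset.mem_insert.1 hd with rfl | hd
    · refine lt_of_le_of_ne (hmin r (Finset.mem_sdiff.2 ⟨hr.1, hr.2.2⟩)) ?_
      intro h; exact hr.2.1 (hinj hr.1 ha'.1 h.symm)
    · exact hlt d hd r (Finset.mem_sdiff.2 ⟨hr.1, hr.2.2⟩)

lemma chop {α : Type*} [DecidableEq α] (rk : α → ℕ) (k w : ℕ) (hk : 0 < k) (m : ℕ) :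
    ∀ R : Finset α, Set.InjOn rk R → R.card = k * m →
    (∀ a ∈ R, k ≤ (R.filter (fun b => rk a ≤ rk b ∧ rk b < rk a + w)).card ∨
      ∀ b ∈ R, rk b < rk a + w) →
    ∃ 𝒟 : Finset (Finset α), (∀ D ∈ 𝒟, D.card = k ∧ ∀ a ∈ D, ∀ b ∈ D, rk b < rk a + w) ∧
      (∀ D ∈ 𝒟, ∀ D' ∈ 𝒟, D ≠ D' → Disjoint D D') ∧ 𝒟.biUnion id = R := by
  induction m with
  | zero =>
    intro R _ hc _
    have : R = ∅ := Finset.card_eq_zero.1 (by simpa using hc)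
    exact ⟨∅, by simp, by simp, by simp [this]⟩
  | succ m ih =>
    intro R hinj hc hcond
    have hkR : k ≤ R.card := by rw [hc, mul_add]; omega
    obtain ⟨D, hD, hDc, hlt⟩ := initial_seg rk R hinj k hkR
    have hRD : (R \ D).card = k * m := by
      rw [Finset.card_sdiff_of_subset hD, hc, hDc, mul_add]; omega
    obtain ⟨𝒟, h1, h2, h3⟩ := ih (R \ D) (hinj.mono (by simp)) hRD (by
      intro a ha
      rcases hcond a (Finset.mem_sdiff.1 ha).1 with h | h
      · left
        refine h.trans (Finset.card_le_card ?_)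
        intro b hb
        rw [Finset.mem_filter] at hb ⊢
        refine ⟨Finset.mem_sdiff.2 ⟨hb.1, fun hbD => ?_⟩, hb.2⟩
        have := hlt b hbD a ha
        omega
      · right; intro b hb; exact h b (Finset.mem_sdiff.1 hb).1)
    have hDdiam : ∀ a ∈ D, ∀ b ∈ D, rk b < rk a + w := by
      intro a ha b hb
      rcases hcond a (hD ha) with h | h
      · by_contra hcon
        have hsub : insert b (R.filter (fun b => rk a ≤ rk b ∧ rk b < rk a + w)) ⊆ D := by
          apply Finset.insert_subset hb
          intro r hr
          rw [Finset.mem_filter] at hr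
          by_contra hrD
          have := hlt b hb r (Finset.mem_sdiff.2 ⟨hr.1, hrD⟩)
          omega
        have := Finset.card_le_card hsub
        rw [Finset.card_insert_of_notMem (by rw [Finset.mem_filter]; omega)] at this
        omega
      · exact h b (hD hb)
    have hdis : ∀ D' ∈ 𝒟, Disjoint D D' := by
      intro D' hD'
      have : D' ⊆ R \ D := by
        rw [← h3]; exact Finset.subset_biUnion_of_mem id hD'
      exact Finset.disjoint_sdiff.mono_right this
    refine ⟨insert D 𝒟, ?_, ?_, ?_⟩
    · intro D' hD'
      rcases Finset.mem_insert.1 hD' with rfl | hD'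
      · exact ⟨hDc, hDdiam⟩
      · exact h1 D' hD'
    · intro A hA B hB hne
      rcases Finset.mem_insert.1 hA with hA' | hA' <;>
        rcases Finset.mem_insert.1 hB with hB' | hB'
      · exact absurd (hA'.trans hB'.symm) hne
      · rw [hA']; exact hdis B hB'
      · rw [hB']; exact (hdis A hA').symm
      · exact h2 A hA' B hB' hne
    · rw [Finset.biUnion_insert, h3]
      exact Finset.union_sdiff_of_subset hD

lemma exists_rk {α : Type*} [DecidableEq α] (X : Finset α) :
    ∃ rk : α → ℕ, Set.InjOn rk X ∧ (∀ x ∈ X, rk x < X.card) ∧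
      ∀ i < X.card, ∃ x ∈ X, rk x = i := by
  classical
  refine ⟨fun x => if h : x ∈ X then (X.equivFin ⟨x, h⟩ : ℕ) else 0, ?_, ?_, ?_⟩
  · intro a ha b hb hab
    have ha' : a ∈ X := ha
    have hb' : b ∈ X := hb
    simp only [ha', hb', dif_pos] at hab
    have := X.equivFin.injective (Fin.ext hab)
    simpa using this
  · intro x hx; simp [hx]
  · intro i hi
    refine ⟨(X.equivFin.symm ⟨i, hi⟩ : X), (X.equivFin.symm ⟨i, hi⟩ : X).2, ?_⟩
    simp

/-- number of elements with rank in an interval -/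
lemma card_window_le {α : Type*} [DecidableEq α] (X : Finset α) (rk : α → ℕ)
    (hinj : Set.InjOn rk X) (a w : ℕ) :
    (X.filter (fun x => a ≤ rk x ∧ rk x < a + w)).card ≤ w := by
  have : (X.filter (fun x => a ≤ rk x ∧ rk x < a + w)).card ≤ (Finset.Ico a (a+w)).card := by
    apply Finset.card_le_card_of_injOn rk
    · intro x hx
      have := (Finset.mem_filter.1 hx).2
      simpa using this
    · exact hinj.mono (by intro x hx; exact (Finset.mem_filter.1 hx).1)
  simpa using this

lemma card_window_ge {α : Type*} [DecidableEq α] (X : Finset α) (rk : α → ℕ)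
    (hsurj : ∀ i < X.card, ∃ x ∈ X, rk x = i) (a w : ℕ) (h : a + w ≤ X.card) :
    w ≤ (X.filter (fun x => a ≤ rk x ∧ rk x < a + w)).card := by
  have : (Finset.Ico a (a+w)).card ≤ (X.filter (fun x => a ≤ rk x ∧ rk x < a + w)).card := by
    apply Finset.card_le_card_of_surjOn rk
    intro i hi
    simp only [Finset.coe_Ico, Set.mem_Ico] at hi
    obtain ⟨x, hx, rfl⟩ := hsurj i (by omega)
    exact ⟨x, by simp [hx, hi], rfl⟩
  simpa using this

/-- short `k`-subsets of `X` -/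
def shortSets {α : Type*} [DecidableEq α] (X : Finset α) (rk : α → ℕ) (k : ℕ) :
    Finset (Finset α) :=
  (X.powersetCard k).filter (fun S => ∀ a ∈ S, ∀ b ∈ S, rk b < rk a + 4 * k)

lemma mem_shortSets {α : Type*} [DecidableEq α] {X : Finset α} {rk : α → ℕ} {k : ℕ}
    {S : Finset α} : S ∈ shortSets X rk k ↔
      (S ⊆ X ∧ S.card = k) ∧ ∀ a ∈ S, ∀ b ∈ S, rk b < rk a + 4 * k := by
  rw [shortSets, Finset.mem_filter, Finset.mem_powersetCard]

lemma card_shortSets {α : Type*} [DecidableEq α] (X : Finset α) (rk : α → ℕ) (k : ℕ) (hk : 0 < k)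
    (hinj : Set.InjOn rk X) : (shortSets X rk k).card ≤ X.card * 2 ^ (4 * k) := by
  have hsub : shortSets X rk k ⊆ X.biUnion (fun a =>
      (X.filter (fun x => rk a ≤ rk x ∧ rk x < rk a + 4 * k)).powerset) := by
    intro S hS
    rw [shortSets, Finset.mem_filter, Finset.mem_powersetCard] at hS
    obtain ⟨⟨hSX, hSc⟩, hS⟩ := hS
    obtain ⟨a, ha, hmin⟩ := Finset.exists_min_image S rk (Finset.card_pos.1 (by omega))
    refine Finset.mem_biUnion.2 ⟨a, hSX ha, Finset.mem_powerset.2 fun x hx => ?_⟩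
    exact Finset.mem_filter.2 ⟨hSX hx, hmin x hx, hS a ha x hx⟩
  refine (Finset.card_le_card hsub).trans (Finset.card_biUnion_le_card_mul _ _ _ ?_)
  intro a _
  rw [Finset.card_powerset]
  exact Nat.pow_le_pow_right (by norm_num) (card_window_le X rk hinj _ _)

end RTT
namespace RTT

section tiling
variable {k n : ℕ} {F : SimpleGraph (Fin k)} {G : SimpleGraph (Fin n)}

lemma SpansCopy.card {S : Finset (Fin n)} (h : SpansCopy F G S) : S.card = k := by
  obtain ⟨f, hf, -, rfl⟩ := h
  rw [Finset.card_image_of_injective _ hf]; simp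

lemma SpansCopy.perf {S : Finset (Fin n)} (h : SpansCopy F G S) : PerfTilingOn F G S := by
  refine ⟨{S}, ⟨?_, ?_⟩, by simp⟩
  · intro A hA; rw [Finset.mem_singleton.1 hA]; exact h
  · intro A hA B hB hne
    exact absurd ((Finset.mem_singleton.1 hA).trans (Finset.mem_singleton.1 hB).symm) hne

lemma PerfTilingOn.dvd {A : Finset (Fin n)} (h : PerfTilingOn F G A) : k ∣ A.card := by
  obtain ⟨T, ⟨h1, h2⟩, rfl⟩ := h
  rw [Finset.card_biUnion (t := id) (fun S hS S' hS' hne => h2 S hS S' hS' hne)]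
  exact Finset.dvd_sum (fun S hS => by simp [(h1 S hS).card])

lemma PerfTilingOn.biUnion {ι : Type*} [DecidableEq ι] (J : Finset ι) (f : ι → Finset (Fin n))
    (h : ∀ j ∈ J, PerfTilingOn F G (f j))
    (hd : ∀ i ∈ J, ∀ j ∈ J, i ≠ j → Disjoint (f i) (f j)) : PerfTilingOn F G (J.biUnion f) := by
  have h1 : ∀ j, ∃ T : Finset (Finset (Fin n)), j ∈ J → IsTiling F G T ∧ T.biUnion id = f j := by
    intro j
    by_cases hj : j ∈ J
    · obtain ⟨T, hT⟩ := h j hj; exact ⟨T, fun _ => hT⟩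
    · exact ⟨∅, fun h => absurd h hj⟩
  choose T hT using h1
  have hsub : ∀ j ∈ J, ∀ S ∈ T j, S ⊆ f j := by
    intro j hj S hS
    rw [← (hT j hj).2]; exact Finset.subset_biUnion_of_mem id hS
  refine ⟨J.biUnion T, ⟨?_, ?_⟩, ?_⟩
  · intro S hS
    obtain ⟨j, hj, hS⟩ := Finset.mem_biUnion.1 hS
    exact (hT j hj).1.1 S hS
  · intro S hS S' hS' hne
    obtain ⟨j, hj, hS⟩ := Finset.mem_biUnion.1 hS
    obtain ⟨j', hj', hS'⟩ := Finset.mem_biUnion.1 hS'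
    by_cases hjj : j = j'
    · subst hjj; exact (hT j hj).1.2 S hS S' hS' hne
    · exact (hd j hj j' hj' hjj).mono (hsub j hj S hS) (hsub j' hj' S' hS')
  · rw [Finset.biUnion_biUnion]
    exact Finset.biUnion_congr rfl (fun j hj => (hT j hj).2)

lemma PerfTilingOn.union {A B : Finset (Fin n)} (hA : PerfTilingOn F G A) (hB : PerfTilingOn F G B)
    (hd : Disjoint A B) : PerfTilingOn F G (A ∪ B) := by
  have := PerfTilingOn.biUnion (F := F) (G := G) (Finset.univ : Finset Bool)
    (fun b => if b then A else B) (by rintro (_|_) _ <;> simpa) (by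
      rintro (_|_) _ (_|_) _ h <;> simp_all [hd.symm])
  simpa using this

lemma absorb (hk : 3 ≤ k) (X : Finset (Fin n)) (rk : Fin n → ℕ)
    (hinj : Set.InjOn rk X) (hlt : ∀ x ∈ X, rk x < X.card)
    (hsurj : ∀ i < X.card, ∃ x ∈ X, rk x = i)
    (g : Finset (Fin n) → Finset (Fin n))
    (hg1 : ∀ S ∈ shortSets X rk k, PerfTilingOn F G (g S))
    (hg2 : ∀ S ∈ shortSets X rk k, PerfTilingOn F G (g S ∪ S))
    (hg3 : ∀ S ∈ shortSets X rk k, Disjoint (g S) X)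
    (hg4 : ∀ S ∈ shortSets X rk k, ∀ S' ∈ shortSets X rk k, S ≠ S' → Disjoint (g S) (g S'))
    (U : Finset (Fin n)) (hU : Disjoint U (X ∪ (shortSets X rk k).biUnion g))
    (fan : Fin n → Finset (Finset (Fin n)))
    (hf1 : ∀ u ∈ U, ∀ S ∈ fan u, S ⊆ X ∧ S.card = k - 1 ∧ SpansCopy F G (insert u S))
    (hf2 : ∀ u ∈ U, ∀ S ∈ fan u, ∀ S' ∈ fan u, S ≠ S' → Disjoint S S')
    (hf3 : ∀ u ∈ U, 2 * k ^ 2 * U.card < (fan u).card)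
    (hdvd : k ∣ (X ∪ (shortSets X rk k).biUnion g ∪ U).card) :
    PerfTilingOn F G (X ∪ (shortSets X rk k).biUnion g ∪ U) := by
  classical
  set J := shortSets X rk k with hJ
  set cl : Finset (Fin n) → Finset (Fin n) := fun A =>
    X.filter (fun x => ∃ a ∈ A, rk x / (2 * k) = rk a / (2 * k)) with hcl
  have hclcard : ∀ u ∈ U, ∀ A ∈ fan u, (cl A).card ≤ 2 * k ^ 2 := by
    intro u hu A hA
    have h1 : cl A ⊆ A.biUnion (fun a => X.filter (fun x =>
        rk a / (2 * k) * (2 * k) ≤ rk x ∧ rk x < rk a / (2 * k) * (2 * k) + 2 * k)) := by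
      intro x hx
      obtain ⟨hxX, a, ha, hxa⟩ := Finset.mem_filter.1 hx
      refine Finset.mem_biUnion.2 ⟨a, ha, Finset.mem_filter.2 ⟨hxX, ?_⟩⟩
      rw [← hxa]
      exact ⟨Nat.div_mul_le_self _ _, Nat.lt_div_mul_add (by omega)⟩
    have h2 := (Finset.card_le_card h1).trans (Finset.card_biUnion_le_card_mul _ _ (2 * k)
      (fun a _ => card_window_le X rk hinj _ _))
    rw [(hf1 u hu A hA).2.1] at h2
    have h3 : (k - 1) * (2 * k) ≤ k * (2 * k) := Nat.mul_le_mul_right _ (by omega)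
    nlinarith
  obtain ⟨h, hh⟩ := greedy cl fan ∅ (2 * k ^ 2) U (by
      intro i hi j hj A hA B hB hAB
      rw [Finset.disjoint_left] at hAB ⊢
      intro b hb hbA
      obtain ⟨hbX, a, ha, hba⟩ := Finset.mem_filter.1 hbA
      exact hAB ha (Finset.mem_filter.2 ⟨(hf1 i hi A hA).1 ha, b, hb, hba.symm⟩))
    hf2 hclcard (by simpa using hf3)
  have hsubcl : ∀ u ∈ U, h u ⊆ cl (h u) := fun u hu x hx =>
    Finset.mem_filter.2 ⟨(hf1 u hu _ (hh u hu).1).1 hx, x, hx, rfl⟩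
  have hhX : ∀ u ∈ U, h u ⊆ X := fun u hu => (hf1 u hu _ (hh u hu).1).1
  have hhd : ∀ u ∈ U, ∀ u' ∈ U, u ≠ u' → Disjoint (h u) (h u') := fun u hu u' hu' hne =>
    ((hh u hu).2.2 u' hu' hne).mono_right (hsubcl u' hu')
  rw [Finset.disjoint_union_right] at hU
  set P := U.biUnion (fun u => insert u (h u)) with hP
  set Q := U.biUnion h with hQ
  set R := X \ Q with hR
  have hQX : Q ⊆ X := Finset.biUnion_subset.2 hhX
  have hPperf : PerfTilingOn F G P := by
    apply PerfTilingOn.biUnion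
    · intro u hu; exact (hf1 u hu _ (hh u hu).1).2.2.perf
    · intro u hu u' hu' hne
      rw [Finset.disjoint_insert_left, Finset.disjoint_insert_right, Finset.mem_insert, not_or]
      exact ⟨⟨hne, fun hm => Finset.disjoint_left.1 hU.1 hu (hhX u' hu' hm)⟩,
        fun hm => Finset.disjoint_left.1 hU.1 hu' (hhX u hu hm), hhd u hu u' hu' hne⟩
  have hPeq : P = U ∪ Q := by
    ext x
    simp only [hP, hQ, Finset.mem_biUnion, Finset.mem_insert, Finset.mem_union]
    constructor
    · rintro ⟨u, hu, rfl | hx⟩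
      · exact Or.inl hu
      · exact Or.inr ⟨u, hu, hx⟩
    · rintro (hx | ⟨u, hu, hx⟩)
      · exact ⟨x, hx, Or.inl rfl⟩
      · exact ⟨u, hu, Or.inr hx⟩
  have hBX : Disjoint (J.biUnion g) X := (Finset.disjoint_biUnion_left _ _ _).2 hg3
  have hPB : Disjoint P (J.biUnion g) := by
    rw [hPeq, Finset.disjoint_union_left]
    exact ⟨hU.2, hBX.symm.mono_left hQX⟩
  have hPR : Disjoint P R := by
    rw [hPeq, Finset.disjoint_union_left]
    exact ⟨hU.1.mono_right Finset.sdiff_subset, Finset.disjoint_sdiff⟩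
  have hRB : Disjoint R (J.biUnion g) := hBX.symm.mono_left Finset.sdiff_subset
  have htot : X ∪ J.biUnion g ∪ U = P ∪ (R ∪ J.biUnion g) := by
    rw [hPeq, hR]
    ext x
    have := @hQX x
    simp only [Finset.mem_union, Finset.mem_sdiff]
    tauto
  have hBperf : PerfTilingOn F G (J.biUnion g) := PerfTilingOn.biUnion _ _ hg1 hg4
  have hRdvd : k ∣ R.card := by
    rw [htot, Finset.card_union_of_disjoint (Finset.disjoint_union_right.2 ⟨hPR, hPB⟩),
      Finset.card_union_of_disjoint hRB] at hdvd
    have h1 := (Nat.dvd_add_right hPperf.dvd).1 hdvd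
    exact (Nat.dvd_add_left hBperf.dvd).1 h1
  obtain ⟨m, hm⟩ := hRdvd
  obtain ⟨𝒟, hD1, hD2, hD3⟩ := chop rk k (4 * k) (by omega) m R
    (hinj.mono (by intro x hx; exact (Finset.mem_sdiff.1 hx).1)) hm (by
    intro a ha
    by_cases hend : rk a + 4 * k ≤ X.card
    · left
      set q := rk a / (2 * k) + 1 with hq
      have hq1 : rk a < q * (2 * k) := by
        rw [hq, add_mul, one_mul]; exact Nat.lt_div_mul_add (by omega)
      have hq2 : q * (2 * k) ≤ rk a + 2 * k := by
        rw [hq, add_mul, one_mul]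
        have := Nat.div_mul_le_self (rk a) (2 * k)
        omega
      have hw := card_window_ge X rk hsurj (q * (2 * k)) (2 * k) (by omega)
      set B := X.filter (fun x => q * (2 * k) ≤ rk x ∧ rk x < q * (2 * k) + 2 * k) with hB
      have hBq : ∀ x ∈ B, rk x / (2 * k) = q := by
        intro x hx
        have := (Finset.mem_filter.1 hx).2
        rw [Nat.div_eq_iff (by omega)]
        constructor
        · omega
        · omega
      have hBQ : (B ∩ Q).card ≤ k - 1 := by
        rcases (B ∩ Q).eq_empty_or_nonempty with h0 | ⟨x, hx⟩
        · simp [h0]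
        · obtain ⟨hxB, hxQ⟩ := Finset.mem_inter.1 hx
          obtain ⟨u, hu, hxu⟩ := Finset.mem_biUnion.1 hxQ
          rw [← (hf1 u hu _ (hh u hu).1).2.1]
          apply Finset.card_le_card
          intro y hy
          obtain ⟨hyB, hyQ⟩ := Finset.mem_inter.1 hy
          obtain ⟨u', hu', hyu⟩ := Finset.mem_biUnion.1 hyQ
          by_cases huu : u = u'
          · rw [huu]; exact hyu
          · exfalso
            refine Finset.disjoint_left.1 ((hh u hu).2.2 u' hu' huu) hxu ?_
            exact Finset.mem_filter.2 ⟨hhX u hu hxu, y, hyu, by rw [hBq x hxB, hBq y hyB]⟩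
      have h3 : (B \ Q).card ≤ (R.filter (fun b => rk a ≤ rk b ∧ rk b < rk a + 4 * k)).card := by
        apply Finset.card_le_card
        intro y hy
        obtain ⟨hyB, hyQ⟩ := Finset.mem_sdiff.1 hy
        obtain ⟨hyX, hy1⟩ := Finset.mem_filter.1 hyB
        exact Finset.mem_filter.2 ⟨Finset.mem_sdiff.2 ⟨hyX, hyQ⟩, by omega, by omega⟩
      have h4 := Finset.card_sdiff_add_card_inter B Q
      omega
    · right
      intro b hb
      have := hlt b (Finset.mem_sdiff.1 hb).1
      omega)
  have hDJ : 𝒟 ⊆ J := by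
    intro D hD
    rw [hJ, mem_shortSets]
    refine ⟨⟨?_, (hD1 D hD).1⟩, (hD1 D hD).2⟩
    have : D ⊆ R := by rw [← hD3]; exact Finset.subset_biUnion_of_mem id hD
    exact this.trans Finset.sdiff_subset
  have hJX : ∀ S ∈ J, S ⊆ X := by
    intro S hS
    rw [hJ, mem_shortSets] at hS
    exact hS.1.1
  have hlast : R ∪ J.biUnion g = J.biUnion (fun S => if S ∈ 𝒟 then g S ∪ S else g S) := by
    rw [← hD3]
    ext x
    simp only [Finset.mem_union, Finset.mem_biUnion, id]
    constructor
    · rintro (⟨D, hD, hx⟩ | ⟨S, hS, hx⟩)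
      · exact ⟨D, hDJ hD, by simp [hD, hx]⟩
      · refine ⟨S, hS, ?_⟩
        split_ifs <;> simp [hx]
    · rintro ⟨S, hS, hx⟩
      split_ifs at hx with hSD
      · rcases Finset.mem_union.1 hx with hx | hx
        · exact Or.inr ⟨S, hS, hx⟩
        · exact Or.inl ⟨S, hSD, hx⟩
      · exact Or.inr ⟨S, hS, hx⟩
  rw [htot]
  refine PerfTilingOn.union hPperf ?_ (Finset.disjoint_union_right.2 ⟨hPR, hPB⟩)
  rw [hlast]
  apply PerfTilingOn.biUnion
  · intro S hS
    split_ifs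
    · exact hg2 S hS
    · exact hg1 S hS
  · intro S hS S' hS' hne
    have e1 := hg4 S hS S' hS' hne
    have e2 := (hg3 S hS).mono_right (hJX S' hS')
    have e3 := ((hg3 S' hS').mono_right (hJX S hS)).symm
    split_ifs with c1 c2 c2
    · rw [Finset.disjoint_union_left, Finset.disjoint_union_right, Finset.disjoint_union_right]
      exact ⟨⟨e1, e2⟩, e3, hD2 S c1 S' c2 hne⟩
    · rw [Finset.disjoint_union_left]; exact ⟨e1, e3⟩
    · rw [Finset.disjoint_union_right]; exact ⟨e1, e2⟩
    · exact e1

end tiling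

end RTT

open RTT in
/-- From fans and many disjoint absorbers within each part of a partition,
one obtains disjoint absorbing sets, one for each part. -/
theorem absorbing_sets_from_absorbers :
    ∀ γ : ℝ, 0 < γ → ∀ k t C : ℕ, 3 ≤ k →
    ∃ ξ : ℝ, 0 < ξ ∧ ∃ N : ℕ, ∀ n : ℕ, N ≤ n →
      ∀ F : SimpleGraph (Fin k), ∀ G : SimpleGraph (Fin n),
      ∀ Vs : Fin C → Finset (Fin n), IsPartition Vs →
        (∀ i, ∀ v ∈ Vs i, ∃ 𝒮 : Finset (Finset (Fin n)),
          IsFan F G v (Vs i) 𝒮 ∧ γ * n ≤ (𝒮.card : ℝ)) →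
        (∀ i, ∀ S ⊆ Vs i, S.card = k → HasManyAbsorbers F G t S (γ * n)) →
        ∃ As : Fin C → Finset (Fin n),
          (∀ i j, i ≠ j → Disjoint (As i) (As j)) ∧
          (∀ i, ((As i).card : ℝ) ≤ (γ / C) * n) ∧
          (∀ i, IsAbsorbingSet F G ξ (Vs i \ Finset.univ.biUnion As) (As i)) := by
  classical
  intro γ hγ k t C hk
  set K : ℕ := 1 + k ^ 2 * t * 2 ^ (4 * k) with hK
  obtain ⟨L, hL⟩ := exists_nat_gt (2 * (K:ℝ) * (C + 1) / γ)
  obtain ⟨μ, hμ, N, hN1, hN⟩ := exists_X γ hγ (k - 1) L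
  have hkpos : (0:ℝ) < k := by exact_mod_cast (by omega : 0 < k)
  refine ⟨μ / (2 * k ^ 2), by positivity, N, ?_⟩
  intro n hn F G Vs hpart hfan habs
  have hnpos : (0:ℝ) < n := by exact_mod_cast (by omega : 0 < n)
  have hex : ∀ v, ∃ i, v ∈ Vs i := by
    intro v
    have : v ∈ Finset.univ.biUnion Vs := by rw [hpart.2]; simp
    simpa using this
  choose ix hix using hex
  have hixu : ∀ i, ∀ v ∈ Vs i, ix v = i := by
    intro i v hv
    by_contra hne
    exact Finset.disjoint_left.1 (hpart.1 _ _ hne) (hix v) hv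
  choose fan hfan1 hfan2 using fun v => hfan (ix v) v (hix v)
  obtain ⟨X, hX1, hX2⟩ := hN n hn fan (fun v S hS => ((hfan1 v).1 S hS).2.1)
    (fun v => (hfan1 v).2) hfan2
  -- size estimate
  have hXK : (X.card : ℝ) * K < γ / (C + 1) * n := by
    have hC : (0:ℝ) < C + 1 := by positivity
    have hL0 : (0:ℝ) < (L:ℝ) + 1 := by positivity
    have hK0 : (0:ℝ) < K := by rw [hK]; positivity
    rw [div_lt_iff₀ hγ] at hL
    rw [div_mul_eq_mul_div, lt_div_iff₀ hC]
    have h1 : (X.card : ℝ) * (L+1) * (K * (C + 1)) < 2 * n * (K * (C+1)) :=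
      mul_lt_mul_of_pos_right hX1 (by positivity)
    have h2 : (2 * (K:ℝ) * (C+1)) * n < (L * γ) * n := mul_lt_mul_of_pos_right hL hnpos
    have h3 : (X.card : ℝ) * K * (C+1) * (L+1) < γ * n * (L+1) := by nlinarith [mul_pos hγ hnpos]
    exact lt_of_mul_lt_mul_right h3 hL0.le
  have hCle : γ / ((C:ℝ) + 1) * n ≤ γ * n := by
    apply mul_le_mul_of_nonneg_right _ hnpos.le
    exact div_le_self hγ.le (by linarith [(Nat.cast_nonneg C : (0:ℝ) ≤ C)])
  set Xs : Fin C → Finset (Fin n) := fun i => X ∩ Vs i with hXs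
  choose rk hrk1 hrk2 hrk3 using fun i => exists_rk (Xs i)
  set J : Fin C → Finset (Finset (Fin n)) := fun i => shortSets (Xs i) (rk i) k with hJ
  have hJm : ∀ i, ∀ S ∈ J i, S ⊆ Xs i ∧ S.card = k := by
    intro i S hS
    simp only [hJ, mem_shortSets] at hS
    exact hS.1
  have hXsV : ∀ i, Xs i ⊆ Vs i := fun i => Finset.inter_subset_right
  have hXsX : ∀ i, Xs i ⊆ X := fun i => Finset.inter_subset_left
  have hXsd : ∀ i j, i ≠ j → Disjoint (Xs i) (Xs j) := fun i j hij =>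
    (hpart.1 i j hij).mono (hXsV i) (hXsV j)
  have hJd : ∀ i j, i ≠ j → ∀ S ∈ J i, ∀ S' ∈ J j, S ≠ S' := by
    rintro i j hij S hS S' hS' rfl
    obtain ⟨x, hx⟩ := Finset.card_pos.1 (by rw [(hJm i S hS).2]; omega : 0 < S.card)
    exact Finset.disjoint_left.1 (hXsd i j hij) ((hJm i S hS).1 hx) ((hJm j S hS').1 hx)
  have hJc : ∀ i, (J i).card ≤ (Xs i).card * 2 ^ (4 * k) := fun i =>
    card_shortSets _ _ k (by omega) (hrk1 i)
  set JJ := Finset.univ.biUnion J with hJJ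
  have hJJc : JJ.card ≤ X.card * 2 ^ (4 * k) := by
    have h1 : JJ.card ≤ ∑ i, (J i).card := Finset.card_biUnion_le
    have h2 : ∑ i, (J i).card ≤ ∑ i, (Xs i).card * 2 ^ (4 * k) :=
      Finset.sum_le_sum (fun i _ => hJc i)
    rw [← Finset.sum_mul, ← Finset.card_biUnion (fun i _ j _ hij => hXsd i j hij)] at h2
    have h3 : (Finset.univ.biUnion Xs).card ≤ X.card :=
      Finset.card_le_card (Finset.biUnion_subset.2 fun i _ => hXsX i)
    exact h1.trans (h2.trans (Nat.mul_le_mul_right _ h3))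
  have hab : ∀ S : Finset (Fin n), ∃ 𝒜 : Finset (Finset (Fin n)), S ∈ JJ →
      (γ * n ≤ (𝒜.card : ℝ) ∧ (∀ A ∈ 𝒜, IsAbsorber F G t S A) ∧
      ∀ A ∈ 𝒜, ∀ A' ∈ 𝒜, A ≠ A' → Disjoint A A') := by
    intro S
    by_cases hS : S ∈ JJ
    · obtain ⟨i, -, hi⟩ := Finset.mem_biUnion.1 hS
      obtain ⟨𝒜, h⟩ := habs i S ((hJm i S hi).1.trans (hXsV i)) (hJm i S hi).2
      exact ⟨𝒜, fun _ => h⟩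
    · exact ⟨∅, fun h => absurd h hS⟩
  choose 𝒜 h𝒜 using hab
  obtain ⟨g, hg⟩ := greedy id 𝒜 X (k ^ 2 * t) JJ
    (fun _ _ _ _ A _ B _ h => h.symm)
    (fun S hS => (h𝒜 S hS).2.2)
    (fun S hS A hA => ((h𝒜 S hS).2.1 A hA).2.1)
    (by
      intro S hS
      have h1 := (h𝒜 S hS).1
      have h2 : X.card + k ^ 2 * t * JJ.card ≤ X.card * K := by
        have := Nat.mul_le_mul_left (k ^ 2 * t) hJJc
        rw [hK]; nlinarith
      have h3 : ((X.card + k ^ 2 * t * JJ.card : ℕ) : ℝ) ≤ X.card * K := by exact_mod_cast h2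
      have h4 : ((X.card + k ^ 2 * t * JJ.card : ℕ) : ℝ) < ((𝒜 S).card : ℝ) := by linarith
      exact_mod_cast h4)
  simp only [id] at hg
  have hJJm : ∀ i, ∀ S ∈ J i, S ∈ JJ := fun i S hS =>
    Finset.mem_biUnion.2 ⟨i, Finset.mem_univ _, hS⟩
  have hgabs : ∀ i, ∀ S ∈ J i, IsAbsorber F G t S (g S) := fun i S hS =>
    (h𝒜 S (hJJm i S hS)).2.1 _ (hg S (hJJm i S hS)).1
  refine ⟨fun i => Xs i ∪ (J i).biUnion g, ?_, ?_, ?_⟩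
  · intro i j hij
    rw [Finset.disjoint_union_left, Finset.disjoint_union_right, Finset.disjoint_union_right]
    refine ⟨⟨hXsd i j hij, ?_⟩, ?_, ?_⟩
    · rw [Finset.disjoint_biUnion_right]
      intro S hS
      exact ((hg S (hJJm j S hS)).2.1.mono_right (hXsX i)).symm
    · rw [Finset.disjoint_biUnion_left]
      intro S hS
      exact (hg S (hJJm i S hS)).2.1.mono_right (hXsX j)
    · rw [Finset.disjoint_biUnion_left]
      intro S hS
      rw [Finset.disjoint_biUnion_right]
      intro S' hS'
      exact (hg S (hJJm i S hS)).2.2 S' (hJJm j S' hS') (hJd i j hij S hS S' hS')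
  · intro i
    have hC1 : (0:ℝ) < C := by
      have : 0 < C := lt_of_le_of_lt (Nat.zero_le _) i.2
      exact_mod_cast this
    have h1 : (Xs i ∪ (J i).biUnion g).card ≤ X.card * K := by
      have e1 := Finset.card_union_le (Xs i) ((J i).biUnion g)
      have e2 : ((J i).biUnion g).card ≤ (J i).card * (k ^ 2 * t) :=
        Finset.card_biUnion_le_card_mul _ _ _ (fun S hS => (hgabs i S hS).2.1)
      have e3 := Finset.card_le_card (hXsX i)
      have e4 : (J i).card ≤ X.card * 2 ^ (4 * k) :=
        (hJc i).trans (Nat.mul_le_mul_right _ e3)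
      have e5 := Nat.mul_le_mul_right (k ^ 2 * t) e4
      rw [hK]; nlinarith
    have h2 : ((Xs i ∪ (J i).biUnion g).card : ℝ) ≤ X.card * K := by exact_mod_cast h1
    have h3 : γ / ((C:ℝ) + 1) * n ≤ γ / C * n := by
      apply mul_le_mul_of_nonneg_right _ hnpos.le
      exact div_le_div_of_nonneg_left hγ.le hC1 (by linarith)
    linarith
  · intro i U hU hUc hdvd
    have hUV : ∀ u ∈ U, ix u = i := fun u hu =>
      hixu i u (Finset.mem_sdiff.1 (Finset.mem_sdiff.1 (hU hu)).1).1
    refine absorb hk (Xs i) (rk i) (hrk1 i) (hrk2 i) (hrk3 i) g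
      (fun S hS => (hgabs i S hS).2.2.1) (fun S hS => (hgabs i S hS).2.2.2)
      (fun S hS => (hg S (hJJm i S hS)).2.1.mono_right (hXsX i))
      (fun S hS S' hS' => (hg S (hJJm i S hS)).2.2 S' (hJJm i S' hS')) U ?_
      (fun v => (fan v).filter (fun S => S ⊆ X)) ?_ ?_ ?_ hdvd
    · exact Finset.disjoint_left.2 fun u hu => (Finset.mem_sdiff.1 (hU hu)).2
    · intro u hu S hS
      obtain ⟨hS1, hS2⟩ := Finset.mem_filter.1 hS
      obtain ⟨h1, h2, h3⟩ := (hfan1 u).1 S hS1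
      refine ⟨Finset.subset_inter hS2 ?_, h2, h3⟩
      rw [← hUV u hu]
      exact h1.trans (Finset.erase_subset _ _)
    · intro u hu S hS S' hS'
      exact (hfan1 u).2 S (Finset.mem_filter.1 hS).1 S' (Finset.mem_filter.1 hS').1
    · intro u hu
      have h1 := hX2 u
      have h2 : 2 * (k:ℝ) ^ 2 * U.card ≤ μ * n := by
        have := mul_le_mul_of_nonneg_left hUc (by positivity : 0 ≤ 2 * (k:ℝ)^2)
        have e : 2 * (k:ℝ)^2 * (μ / (2 * k ^ 2) * n) = μ * n := by field_simp
        linarith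
      have h3 : ((2 * k ^ 2 * U.card : ℕ) : ℝ)
          < (((fan u).filter (fun S => S ⊆ X)).card : ℝ) := by
        push_cast; linarith
      exact_mod_cast h3
end

section
/- For any constant δ > 0 and integer k ≥ 2, there exist β > 0 and an integer t > 0 such that the following holds for all sufficiently large n ∈ ℕ. Let G be an n-vertex graph and F a k-vertex graph. If every vertex of G is (F, δn, 1)-reachable to at least δn other vertices, then there is a partition {V_1, …, V_C} of V(G) for some integer C ≤ ⌈1/δ⌉ such that for each i ∈ [C] the set V_i is (F, βn, t)-closed and |V_i| ≥ (δ/2)n. -/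
open Finset

namespace RTT

theorem perf_union {k n : ℕ} {F : SimpleGraph (Fin k)} {G : SimpleGraph (Fin n)}
    {A B : Finset (Fin n)} (hA : PerfTilingOn F G A) (hB : PerfTilingOn F G B)
    (h : Disjoint A B) : PerfTilingOn F G (A ∪ B) := by
  obtain ⟨T₁, ⟨h1, h2⟩, rfl⟩ := hA
  obtain ⟨T₂, ⟨h3, h4⟩, rfl⟩ := hB
  have key : ∀ S ∈ T₁, ∀ S' ∈ T₂, Disjoint S S' := by
    intro S hS S' hS'
    exact Disjoint.mono (Finset.subset_biUnion_of_mem id hS)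
      (Finset.subset_biUnion_of_mem id hS') h
  refine ⟨T₁ ∪ T₂, ⟨?_, ?_⟩, ?_⟩
  · intro S hS
    rcases Finset.mem_union.1 hS with hS | hS
    · exact h1 S hS
    · exact h3 S hS
  · intro S hS S' hS' hne
    rcases Finset.mem_union.1 hS with hS | hS <;> rcases Finset.mem_union.1 hS' with hS' | hS'
    · exact h2 S hS S' hS' hne
    · exact key S hS S' hS'
    · exact (key S' hS' S hS).symm
    · exact h4 S hS S' hS' hne
  · exact Finset.union_biUnion

theorem freach_symm {k n : ℕ} {F : SimpleGraph (Fin k)} {G : SimpleGraph (Fin n)}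
    {m : ℝ} {t : ℕ} {u v : Fin n} (h : FReachable F G m t u v) : FReachable F G m t v u := by
  intro W hW
  obtain ⟨S, a, b, c, d, e, f⟩ := h W hW
  exact ⟨S, a, c, b, d, f, e⟩

theorem freach_mono {k n : ℕ} {F : SimpleGraph (Fin k)} {G : SimpleGraph (Fin n)}
    {m m' : ℝ} {t t' : ℕ} {u v : Fin n} (h : FReachable F G m t u v) (hm : m' ≤ m)
    (ht : t ≤ t') : FReachable F G m' t' u v := by
  intro W hW
  obtain ⟨S, a, b, c, d, e, f⟩ := h W (hW.trans hm)
  exact ⟨S, a, b, c, d.trans (Nat.sub_le_sub_right (Nat.mul_le_mul_left k ht) 1), e, f⟩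

theorem freach_concat {k n : ℕ} (hk : 1 ≤ k) {F : SimpleGraph (Fin k)} {G : SimpleGraph (Fin n)}
    {m m' : ℝ} {t : ℕ} (ht : 1 ≤ t) {u v : Fin n} (huv : u ≠ v) (X : Finset (Fin n))
    (hX : ∀ w ∈ X, w ≠ u → w ≠ v → FReachable F G m t u w ∧ FReachable F G m t w v)
    (hc : m' + 2 < X.card) (hm : m' + k * t + 1 ≤ m) : FReachable F G m' (2 * t) u v := by
  intro W hW
  have hw : ∃ w ∈ X, w ∉ W ∪ {u, v} := by
    apply Finset.exists_mem_notMem_of_card_lt_card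
    have h1 := Finset.card_union_le W {u, v}
    have h2 : ({u, v} : Finset (Fin n)).card ≤ 2 := Finset.card_le_two
    have h3 : (W.card : ℝ) + 2 < X.card := by linarith
    have h4 : W.card + 2 < X.card := by exact_mod_cast h3
    omega
  obtain ⟨w, hwX, hw⟩ := hw
  simp only [Finset.mem_union, Finset.mem_insert, Finset.mem_singleton, not_or] at hw
  obtain ⟨hwW, hwu, hwv⟩ := hw
  obtain ⟨r1, r2⟩ := hX w hwX hwu hwv
  have hkt : 1 ≤ k * t := Nat.mul_pos hk ht
  have hktR : (1 : ℝ) ≤ k * t := by exact_mod_cast hkt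
  obtain ⟨S1, d1, u1, w1, c1, p1, q1⟩ := r1 (insert v W) (by
    have := Finset.card_insert_le v W
    have : ((insert v W).card : ℝ) ≤ W.card + 1 := by exact_mod_cast this
    linarith)
  obtain ⟨S2, d2, w2, v2, c2, p2, q2⟩ := r2 (insert u (W ∪ S1)) (by
    have h1 := Finset.card_insert_le u (W ∪ S1)
    have h2 := Finset.card_union_le W S1
    have h3 : (insert u (W ∪ S1)).card ≤ W.card + k * t + 1 := by omega
    have : ((insert u (W ∪ S1)).card : ℝ) ≤ W.card + k * t + 1 := by exact_mod_cast h3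
    linarith)
  rw [Finset.disjoint_insert_right] at d1 d2
  obtain ⟨v1, d1⟩ := d1
  obtain ⟨u2, d2⟩ := d2
  rw [Finset.disjoint_union_right] at d2
  obtain ⟨d2, d12⟩ := d2
  refine ⟨insert w (S1 ∪ S2), ?_, ?_, ?_, ?_, ?_, ?_⟩
  · rw [Finset.disjoint_insert_left, Finset.disjoint_union_left]
    exact ⟨hwW, d1, d2⟩
  · simp [u1, u2, Ne.symm hwu]
  · simp [v1, v2, Ne.symm hwv]
  · have h1 := Finset.card_insert_le w (S1 ∪ S2)
    have h2 := Finset.card_union_le S1 S2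
    have h3 : k * (2 * t) = 2 * (k * t) := by ring
    omega
  · have := perf_union p1 p2 (by
      rw [Finset.disjoint_insert_left, Finset.disjoint_insert_right]
      simp [u2, w1, d12.symm, Ne.symm hwu])
    convert this using 1
    ext x; simp; tauto
  · have := perf_union q1 q2 (by
      rw [Finset.disjoint_insert_left, Finset.disjoint_insert_right]
      simp [v1, w2, d12.symm, hwv])
    convert this using 1
    ext x; simp

open Classical in
/-- The part of `N a` outside the other `N b`. -/
noncomputable def priv {V : Type} [Fintype V] (A : Finset V) (N : V → Finset V) (a : V) : Finset V :=
  N a \ (A.erase a).biUnion N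

theorem mem_priv {V : Type} [Fintype V] {A : Finset V} {N : V → Finset V} {a x : V} :
    x ∈ priv A N a ↔ x ∈ N a ∧ ∀ b ∈ A, b ≠ a → x ∉ N b := by
  classical
  simp only [priv, Finset.mem_sdiff, Finset.mem_biUnion, Finset.mem_erase]
  constructor
  · rintro ⟨h, h'⟩
    exact ⟨h, fun b hb hba hx => h' ⟨b, ⟨hba, hb⟩, hx⟩⟩
  · rintro ⟨h, h'⟩
    exact ⟨h, fun ⟨b, ⟨hba, hb⟩, hx⟩ => h' b hb hba hx⟩

open Classical in
theorem priv_card {V : Type} [Fintype V] (A : Finset V) (N : V → Finset V) (x : ℝ) (hx : 0 ≤ x)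
    (h : ∀ a ∈ A, ∀ b ∈ A, a ≠ b → ((N a ∩ N b).card : ℝ) ≤ x) (a : V) (ha : a ∈ A) :
    ((N a).card : ℝ) - A.card * x ≤ (priv A N a).card := by
  have h1 : N a ⊆ priv A N a ∪ (A.erase a).biUnion (fun b => N a ∩ N b) := by
    intro y hy
    by_cases hp : y ∈ priv A N a
    · exact Finset.mem_union_left _ hp
    · rw [mem_priv] at hp
      push Not at hp
      obtain ⟨b, hb, hba, hyb⟩ := hp hy
      refine Finset.mem_union_right _ (Finset.mem_biUnion.2 ⟨b, ?_, ?_⟩)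
      · exact Finset.mem_erase.2 ⟨hba, hb⟩
      · exact Finset.mem_inter.2 ⟨hy, hyb⟩
  have h2 := (Finset.card_le_card h1).trans (Finset.card_union_le _ _)
  have h3 : (((A.erase a).biUnion (fun b => N a ∩ N b)).card : ℝ) ≤ A.card * x := by
    calc (((A.erase a).biUnion (fun b => N a ∩ N b)).card : ℝ)
        ≤ ((∑ b ∈ A.erase a, (N a ∩ N b).card : ℕ) : ℝ) := by exact_mod_cast Finset.card_biUnion_le
      _ = ∑ b ∈ A.erase a, ((N a ∩ N b).card : ℝ) := by push_cast; rfl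
      _ ≤ ∑ b ∈ A.erase a, x := Finset.sum_le_sum (fun b hb =>
          h a ha b (Finset.mem_of_mem_erase hb) (Finset.ne_of_mem_erase hb).symm)
      _ = (A.erase a).card * x := by simp
      _ ≤ A.card * x := by
          gcongr
          exact Finset.erase_subset _ _
  have h4 : ((N a).card : ℝ) ≤ (priv A N a).card + ((A.erase a).biUnion (fun b => N a ∩ N b)).card := by
    exact_mod_cast h2
  linarith

open Classical in
theorem abstract_part {V : Type} [Fintype V] [Nonempty V] (R : ℕ → V → V → Prop)
    (hrefl : ∀ j v, R j v v) (hsymm : ∀ j u v, R j u v → R j v u)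
    (c : ℕ) (δ ε : ℝ) (hε : 0 < ε) (hc : 1 ≤ c * δ) (hδ : 0 < δ)
    (hce : ((c : ℝ) + 1) ^ 2 * ε ≤ δ / 2)
    (hmono : ∀ i j, i ≤ j → j ≤ c + 2 → ∀ u v, R i u v → R j u v)
    (hdeg : ∀ v, δ * Fintype.card V ≤ (Finset.univ.filter (fun u => R 0 v u)).card)
    (H : ∀ j, j ≤ c + 1 → ∀ u v, ∀ X : Finset V, (∀ w ∈ X, R j u w ∧ R j w v) →
      ε * Fintype.card V ≤ X.card → R (j + 1) u v) :
    ∃ A : Finset V, A.card ≤ c ∧ ∃ f : V → V, (∀ v, f v ∈ A) ∧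
      (∀ a ∈ A, δ / 2 * Fintype.card V ≤ (Finset.univ.filter (fun v => f v = a)).card) ∧
      ∀ u v, f u = f v → R (c + 2) u v := by
  set n : ℝ := (Fintype.card V : ℝ) with hn
  have hnpos : 0 < n := by rw [hn]; exact_mod_cast Fintype.card_pos
  let N : ℕ → V → Finset V := fun j v => Finset.univ.filter (fun u => R j v u)
  have memN : ∀ j v u, u ∈ N j v ↔ R j v u := by intro j v u; simp [N]
  -- pairwise intersections
  have hint : ∀ j, j ≤ c + 1 → ∀ A : Finset V,
      (∀ a ∈ A, ∀ b ∈ A, a ≠ b → ¬ R (j + 1) a b) →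
      ∀ a ∈ A, ∀ b ∈ A, a ≠ b → ((N j a ∩ N j b).card : ℝ) ≤ ε * n := by
    intro j hj A hA a ha b hb hab
    by_contra hlt
    push Not at hlt
    refine hA a ha b hb hab (H j hj a b (N j a ∩ N j b) ?_ hlt.le)
    intro w hw
    rw [Finset.mem_inter, memN, memN] at hw
    exact ⟨hw.1, hsymm _ _ _ hw.2⟩
  have hNlarge : ∀ j, j ≤ c + 2 → ∀ a, δ * n ≤ (N j a).card := by
    intro j hj a
    refine (hdeg a).trans ?_
    have : Finset.univ.filter (fun u => R 0 a u) ⊆ N j a := by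
      intro u hu
      rw [memN]
      exact hmono 0 j (Nat.zero_le _) hj _ _ (by simpa using hu)
    exact_mod_cast Finset.card_le_card this
  let P : ℕ → Prop := fun d => ∃ A : Finset V, A.card = d ∧
    ∀ a ∈ A, ∀ b ∈ A, a ≠ b → ¬ R (c + 2 - d) a b
  have P1 : P 1 := by
    obtain ⟨v⟩ := ‹Nonempty V›
    refine ⟨{v}, by simp, ?_⟩
    intro a ha b hb hab
    rw [Finset.mem_singleton] at ha hb
    exact absurd (ha.trans hb.symm) hab
  have disj : ∀ (A : Finset V) (M : V → Finset V), ∀ a ∈ A, ∀ b ∈ A, a ≠ b →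
      Disjoint (priv A M a) (priv A M b) := by
    intro A M a ha b hb hab
    rw [Finset.disjoint_left]
    intro x hx hx'
    rw [mem_priv] at hx hx'
    exact hx.2 b hb hab.symm hx'.1
  have Pc : ¬ P (c + 1) := by
    rintro ⟨A, hAc, hA⟩
    have e1 : c + 2 - (c + 1) = 0 + 1 := by omega
    rw [e1] at hA
    have h1 := priv_card A (N 0) (ε * n) (by positivity) (hint 0 (by omega) A hA)
    have h2 : ∑ a ∈ A, ((priv A (N 0) a).card : ℝ) ≤ n := by
      have : (A.biUnion (priv A (N 0))).card ≤ Fintype.card V := Finset.card_le_univ _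
      rw [Finset.card_biUnion (disj A (N 0))] at this
      rw [hn]
      exact_mod_cast this
    have h3 : ∑ a ∈ A, (δ * n - ((c : ℝ) + 1) * (ε * n)) ≤ ∑ a ∈ A, ((priv A (N 0) a).card : ℝ) := by
      refine Finset.sum_le_sum (fun a ha => ?_)
      have := h1 a ha
      rw [hAc] at this
      push_cast at this
      have := hNlarge 0 (by omega) a
      linarith
    rw [Finset.sum_const, hAc, nsmul_eq_mul] at h3
    push_cast at h3
    have h4 : ((c : ℝ) + 1) * (δ * n - ((c : ℝ) + 1) * (ε * n)) =
      (c * δ + δ - ((c : ℝ) + 1) ^ 2 * ε) * n := by ring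
    rw [h4] at h3
    have h5 : (1 + δ / 2) * n ≤ (c * δ + δ - ((c : ℝ) + 1) ^ 2 * ε) * n := by
      apply mul_le_mul_of_nonneg_right _ hnpos.le
      linarith
    nlinarith [mul_pos hδ hnpos]
  have hd : ∃ d, 1 ≤ d ∧ d ≤ c ∧ P d ∧ ¬ P (d + 1) := by
    by_contra hcon
    push Not at hcon
    have : ∀ d, 1 ≤ d → d ≤ c + 1 → P d := by
      intro d hd
      induction d, hd using Nat.le_induction with
      | base => intro _; exact P1
      | succ d hd ih => intro hd'; exact hcon d hd (by omega) (ih (by omega))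
    exact Pc (this (c + 1) (by omega) le_rfl)
  obtain ⟨d, hd1, hdc, ⟨A, hAd, hA⟩, hPd⟩ := hd
  obtain ⟨l, hl⟩ : ∃ l, l + d = c + 1 := ⟨c + 1 - d, by omega⟩
  have e1 : c + 2 - d = l + 1 := by omega
  rw [e1] at hA
  have hA' : ∀ a ∈ A, ∀ b ∈ A, a ≠ b → ¬ R l a b := fun a ha b hb hab h =>
    hA a ha b hb hab (hmono l (l + 1) (by omega) (by omega) _ _ h)
  have hmax : ∀ B : Finset V, B.card = d + 1 → ∃ a ∈ B, ∃ b ∈ B, a ≠ b ∧ R l a b := by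
    intro B hB
    by_contra hcon
    push Not at hcon
    refine hPd ⟨B, hB, ?_⟩
    have : c + 2 - (d + 1) = l := by omega
    rw [this]
    exact hcon
  have hcov : ∀ v, ∃ a ∈ A, v ∈ N l a := by
    intro v
    by_contra hcon
    push Not at hcon
    have hvA : v ∉ A := fun h => hcon v h ((memN _ _ _).2 (hrefl _ _))
    obtain ⟨a, ha, b, hb, hab, hr⟩ := hmax (insert v A) (by rw [Finset.card_insert_of_notMem hvA, hAd])
    rw [Finset.mem_insert] at ha hb
    rcases ha with rfl | ha <;> rcases hb with rfl | hb
    · exact hab rfl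
    · exact hcon b hb ((memN _ _ _).2 (hsymm _ _ _ hr))
    · exact hcon a ha ((memN _ _ _).2 hr)
    · exact hA' a ha b hb hab hr
  let U : V → Finset V := priv A (N l)
  have hUclosed : ∀ a ∈ A, ∀ u ∈ U a, ∀ v ∈ U a, R l u v := by
    intro a ha u hu v hv
    by_contra hcon
    have huv : u ≠ v := fun h => hcon (h ▸ hrefl _ _)
    have hu' := (mem_priv.1 hu).2
    have hv' := (mem_priv.1 hv).2
    have huA : ∀ b ∈ A.erase a, ¬ R l b u := fun b hb h =>
      hu' b (Finset.mem_of_mem_erase hb) (Finset.ne_of_mem_erase hb) ((memN _ _ _).2 h)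
    have hvA : ∀ b ∈ A.erase a, ¬ R l b v := fun b hb h =>
      hv' b (Finset.mem_of_mem_erase hb) (Finset.ne_of_mem_erase hb) ((memN _ _ _).2 h)
    have n1 : v ∉ A.erase a := fun h => hvA v h (hrefl _ _)
    have n2 : u ∉ insert v (A.erase a) := by
      rw [Finset.mem_insert, not_or]
      exact ⟨huv, fun h => huA u h (hrefl _ _)⟩
    obtain ⟨x, hx, y, hy, hxy, hr⟩ := hmax (insert u (insert v (A.erase a))) (by
      rw [Finset.card_insert_of_notMem n2, Finset.card_insert_of_notMem n1,
        Finset.card_erase_of_mem ha, hAd]; omega)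
    rw [Finset.mem_insert, Finset.mem_insert] at hx hy
    rcases hx with rfl | rfl | hx <;> rcases hy with rfl | rfl | hy
    · exact hxy rfl
    · exact hcon hr
    · exact huA y hy (hsymm _ _ _ hr)
    · exact hcon (hsymm _ _ _ hr)
    · exact hxy rfl
    · exact hvA y hy (hsymm _ _ _ hr)
    · exact huA x hx hr
    · exact hvA x hx hr
    · exact hA' x (Finset.mem_of_mem_erase hx) y (Finset.mem_of_mem_erase hy) hxy hr
  have hinter := hint l (by omega) A hA
  have hdR : (d : ℝ) ≤ c := by exact_mod_cast hdc
  have hd0 : (0 : ℝ) ≤ d := Nat.cast_nonneg d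
  have hεn : 0 < ε * n := mul_pos hε hnpos
  have hce' : ((c : ℝ) + 1) ^ 2 * (ε * n) ≤ δ / 2 * n := by
    have := mul_le_mul_of_nonneg_right hce hnpos.le
    linarith
  have hdd : ((d : ℝ) * d + d) * (ε * n) ≤ δ / 2 * n := by
    refine le_trans ?_ hce'
    apply mul_le_mul_of_nonneg_right _ hεn.le
    nlinarith
  have hUcard : ∀ a ∈ A, δ / 2 * n ≤ (U a).card := by
    intro a ha
    have h1 := priv_card A (N l) (ε * n) hεn.le hinter a ha
    have h2 := hNlarge l (by omega) a
    rw [hAd] at h1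
    have h3 : (d : ℝ) * (ε * n) ≤ ((d : ℝ) * d + d) * (ε * n) :=
      mul_le_mul_of_nonneg_right (by nlinarith) hεn.le
    have h4 : ((priv A (N l) a).card : ℝ) = (U a).card := rfl
    linarith
  -- leftover vertices
  have hassign : ∀ v, ∃ a ∈ A, v ∈ U a ∨
      (ε * n ≤ ((N 0 v ∩ U a).card : ℝ) ∧ ∀ b ∈ A, v ∉ U b) := by
    intro v
    by_cases hv : ∃ a ∈ A, v ∈ U a
    · obtain ⟨a, ha, h⟩ := hv
      exact ⟨a, ha, Or.inl h⟩
    by_contra hcon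
    push Not at hcon hv
    have hsmall : ∀ a ∈ A, ((N 0 v ∩ U a).card : ℝ) ≤ ε * n := by
      intro a ha
      by_contra hlt
      push Not at hlt
      obtain ⟨b, hb, hb'⟩ := (hcon a ha).2 hlt.le
      exact hv b hb hb'
    have hsub : N 0 v ⊆ A.biUnion (fun a => N 0 v ∩ U a) ∪
        A.biUnion (fun a => (A.erase a).biUnion (fun b => N l a ∩ N l b)) := by
      intro y hy
      obtain ⟨a, ha, hya⟩ := hcov y
      by_cases hp : y ∈ U a
      · exact Finset.mem_union_left _ (Finset.mem_biUnion.2 ⟨a, ha, Finset.mem_inter.2 ⟨hy, hp⟩⟩)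
      · have hp' : ¬ (y ∈ N l a ∧ ∀ b ∈ A, b ≠ a → y ∉ N l b) := fun h => hp (mem_priv.2 h)
        push Not at hp'
        obtain ⟨b, hb, hba, hyb⟩ := hp' hya
        exact Finset.mem_union_right _ (Finset.mem_biUnion.2 ⟨a, ha, Finset.mem_biUnion.2
          ⟨b, Finset.mem_erase.2 ⟨hba, hb⟩, Finset.mem_inter.2 ⟨hya, hyb⟩⟩⟩)
    have bnd : ∀ (B : Finset V) (g : V → Finset V) (x : ℝ),
        (∀ a ∈ B, ((g a).card : ℝ) ≤ x) → ((B.biUnion g).card : ℝ) ≤ B.card * x := by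
      intro B g x hg
      calc ((B.biUnion g).card : ℝ) ≤ ((∑ b ∈ B, (g b).card : ℕ) : ℝ) := by
            exact_mod_cast Finset.card_biUnion_le
        _ = ∑ b ∈ B, ((g b).card : ℝ) := by push_cast; rfl
        _ ≤ ∑ b ∈ B, x := Finset.sum_le_sum hg
        _ = B.card * x := by simp
    have b1 := bnd A (fun a => N 0 v ∩ U a) _ hsmall
    have b2 := bnd A (fun a => (A.erase a).biUnion (fun b => N l a ∩ N l b)) (d * (ε * n)) (by
      intro a ha
      refine (bnd (A.erase a) (fun b => N l a ∩ N l b) (ε * n) (fun b hb =>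
        hinter a ha b (Finset.mem_of_mem_erase hb) (Finset.ne_of_mem_erase hb).symm)).trans ?_
      apply mul_le_mul_of_nonneg_right _ hεn.le
      rw [← hAd]
      exact_mod_cast Finset.card_le_card (Finset.erase_subset _ _))
    have b3 := (Finset.card_le_card hsub).trans (Finset.card_union_le _ _)
    have b4 : ((N 0 v).card : ℝ) ≤ ((A.biUnion (fun a => N 0 v ∩ U a)).card : ℝ) +
      ((A.biUnion (fun a => (A.erase a).biUnion (fun b => N l a ∩ N l b))).card : ℝ) := by
      exact_mod_cast b3
    have b5 := hNlarge 0 (by omega) v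
    rw [hAd] at b1 b2
    have b6 : ((d : ℝ) * d + d) * (ε * n) = d * (ε * n) + d * (d * (ε * n)) := by ring
    nlinarith [mul_pos hδ hnpos]
  choose f hfA hf using hassign
  have hfU : ∀ v, ∀ w ∈ U (f v), R (l + 1) v w := by
    intro v w hw
    rcases hf v with h | ⟨h, _⟩
    · exact hmono l (l + 1) (by omega) (by omega) _ _ (hUclosed _ (hfA v) v h w hw)
    · refine H l (by omega) v w _ ?_ h
      intro x hx
      rw [Finset.mem_inter, memN] at hx
      exact ⟨hmono 0 l (by omega) (by omega) _ _ hx.1, hUclosed _ (hfA v) x hx.2 w hw⟩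
  refine ⟨A, by omega, f, hfA, ?_, ?_⟩
  · intro a ha
    refine (hUcard a ha).trans ?_
    have : U a ⊆ Finset.univ.filter (fun v => f v = a) := by
      intro v hv
      rw [Finset.mem_filter]
      refine ⟨Finset.mem_univ _, ?_⟩
      by_contra hne
      rcases hf v with h | ⟨_, h⟩
      · exact Finset.disjoint_left.1 (disj A (N l) (f v) (hfA v) a ha hne) h hv
      · exact h a ha hv
    exact_mod_cast Finset.card_le_card this
  · intro u v huv
    have key : R (l + 2) u v := by
      rcases hf u with h | ⟨h, _⟩
      · rw [huv] at h
        exact hmono (l + 1) (l + 2) (by omega) (by omega) _ _ (hsymm _ _ _ (hfU v u h))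
      · refine H (l + 1) (by omega) u v _ ?_ h
        intro x hx
        rw [Finset.mem_inter] at hx
        refine ⟨hfU u x hx.2, hsymm _ _ _ (hfU v x ?_)⟩
        rw [← huv]; exact hx.2
    exact hmono (l + 2) (c + 2) (by omega) le_rfl _ _ key

end RTT

open RTT in
/-- Partition lemma: if every vertex is `(F,δn,1)`-reachable to at least
`δn` other vertices, then the vertex set can be partitioned into at most `⌈1/δ⌉` parts,
each `(F,βn,t)`-closed and of size at least `(δ/2)n`. -/
theorem partition_lemma :
    ∀ δ : ℝ, 0 < δ → ∀ k : ℕ, 2 ≤ k →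
    ∃ β : ℝ, ∃ t : ℕ, 0 < β ∧ 0 < t ∧ ∃ N : ℕ, ∀ n : ℕ, N ≤ n →
      ∀ F : SimpleGraph (Fin k), ∀ G : SimpleGraph (Fin n),
        (∀ v : Fin n, ∃ R : Finset (Fin n), v ∉ R ∧ δ * n ≤ (R.card : ℝ) ∧
          ∀ u ∈ R, FReachable F G (δ * n) 1 v u) →
        ∃ C : ℕ, C ≤ ⌈1 / δ⌉₊ ∧
        ∃ P : Fin C → Finset (Fin n), IsPartition P ∧
          ∀ i, FClosed F G (β * n) t (P i) ∧ (δ / 2) * n ≤ ((P i).card : ℝ) := by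
  intro δ hδ k hk
  set c : ℕ := ⌈1 / δ⌉₊ with hcdef
  have hc : 1 ≤ (c : ℝ) * δ := by
    have := Nat.le_ceil (1 / δ)
    rw [div_le_iff₀ hδ] at this
    exact this
  have hc0 : (0 : ℝ) ≤ c := Nat.cast_nonneg c
  obtain ⟨ε, hε⟩ : ∃ ε : ℝ, ε = δ / (2 * ((c : ℝ) + 1) ^ 2) := ⟨_, rfl⟩
  have hεpos : 0 < ε := by rw [hε]; positivity
  have hce : ((c : ℝ) + 1) ^ 2 * ε = δ / 2 := by rw [hε]; field_simp
  have hεδ : ε ≤ δ := by nlinarith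
  obtain ⟨N, hN⟩ := exists_nat_gt ((((k : ℝ) * 2 ^ (c + 2) + 2) * 2 ^ (c + 3)) / ε)
  refine ⟨ε / 2 ^ (c + 2), 2 ^ (c + 2), by positivity, by positivity, N + 1, ?_⟩
  intro n hn F G hreach
  have hnN : (N : ℝ) ≤ n := by exact_mod_cast (by omega : N ≤ n)
  have hnbig : ((k : ℝ) * 2 ^ (c + 2) + 2) * 2 ^ (c + 3) < ε * n := by
    have := hN.trans_le hnN
    rw [div_lt_iff₀ hεpos] at this
    linarith
  have hn0 : (0 : ℝ) ≤ n := Nat.cast_nonneg n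
  have : Nonempty (Fin n) := ⟨⟨0, by omega⟩⟩
  classical
  obtain ⟨A, hAc, f, hfA, hsize, hrel⟩ := abstract_part (V := Fin n)
    (fun j u v => u = v ∨ FReachable F G (ε / 2 ^ j * n) (2 ^ j) u v)
    (fun j v => Or.inl rfl)
    (fun j u v h => h.elim (fun h => Or.inl h.symm) (fun h => Or.inr (freach_symm h)))
    c δ ε hεpos hc hδ hce.le
    (by
      intro i j hij _ u v h
      refine h.imp id (fun h => freach_mono h ?_ ?_)
      · apply mul_le_mul_of_nonneg_right _ hn0
        exact div_le_div_of_nonneg_left hεpos.le (by positivity)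
          (pow_le_pow_right₀ (by norm_num) hij)
      · exact Nat.pow_le_pow_right (by norm_num) hij)
    (by
      intro v
      obtain ⟨R, _, hR, hR'⟩ := hreach v
      rw [Fintype.card_fin]
      refine hR.trans ?_
      have : R ⊆ Finset.univ.filter (fun u => v = u ∨ FReachable F G (ε / 2 ^ 0 * n) (2 ^ 0) v u) := by
        intro u hu
        rw [Finset.mem_filter]
        refine ⟨Finset.mem_univ _, Or.inr (freach_mono (hR' u hu) ?_ (by simp))⟩
        simp only [pow_zero, div_one]
        exact mul_le_mul_of_nonneg_right hεδ hn0
      exact_mod_cast Finset.card_le_card this)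
    (by
      intro j hj u v X hX hXc
      by_cases huv : u = v
      · exact Or.inl huv
      right
      rw [Fintype.card_fin] at hXc
      rw [pow_succ' (2 : ℝ) j, pow_succ' (2 : ℕ) j]
      have p1 : (1 : ℝ) ≤ 2 ^ j := one_le_pow₀ (by norm_num)
      have p2 : (2 : ℝ) ^ j ≤ 2 ^ (c + 2) := pow_le_pow_right₀ (by norm_num) (by omega)
      have p3 : (2 : ℝ) ^ (j + 1) ≤ 2 ^ (c + 3) := pow_le_pow_right₀ (by norm_num) (by omega)
      have hk0 : (0 : ℝ) ≤ k := Nat.cast_nonneg k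
      have hstep : ε / (2 * 2 ^ j) * n = (ε / 2 ^ j * n) / 2 := by field_simp
      have hhalf : (k : ℝ) * 2 ^ j + 2 < ε / (2 * 2 ^ j) * n := by
        rw [div_mul_eq_mul_div, lt_div_iff₀ (by positivity), ← pow_succ']
        refine lt_of_le_of_lt ?_ hnbig
        gcongr
      have hle : ε / 2 ^ j * n ≤ ε * n := by
        apply mul_le_mul_of_nonneg_right _ hn0
        exact div_le_self hεpos.le p1
      refine freach_concat (m := ε / 2 ^ j * n) (by omega : 1 ≤ k) Nat.one_le_two_pow huv X ?_ ?_ ?_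
      · intro w hw hwu hwv
        obtain ⟨h1, h2⟩ := hX w hw
        exact ⟨h1.resolve_left (Ne.symm hwu), h2.resolve_left hwv⟩
      · have : 0 ≤ (k : ℝ) * 2 ^ j := by positivity
        linarith
      · push_cast
        linarith)
  refine ⟨A.card, hAc, fun i => Finset.univ.filter (fun v => f v = (A.equivFin.symm i : Fin n)),
    ⟨?_, ?_⟩, ?_⟩
  · intro i j hij
    rw [Finset.disjoint_left]
    intro x hx hx'
    simp only [Finset.mem_filter, Finset.mem_univ, true_and] at hx hx'
    exact hij (A.equivFin.symm.injective (Subtype.ext (hx.symm.trans hx')))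
  · ext v
    simp only [Finset.mem_biUnion, Finset.mem_filter, Finset.mem_univ, true_and, iff_true]
    exact ⟨A.equivFin ⟨f v, hfA v⟩, by simp⟩
  · intro i
    constructor
    · intro u hu v hv huv
      simp only [Finset.mem_filter, Finset.mem_univ, true_and] at hu hv
      exact (hrel u v (hu.trans hv.symm)).resolve_left huv
    · have := hsize _ (A.equivFin.symm i).2
      rw [Fintype.card_fin] at this
      convert this using 3
      ext v; simp
end

section
/- Fix an integer k ≥ 3, a k-vertex graph F and a constant η > 0 such that either (i) F is a tree on k vertices, or (ii) F = C_k with k ≥ 4 and η ≥ 1/k. Then for any μ > 0 there exist α, β > 0 and t ∈ ℕ such that the following holds for all sufficiently large n ∈ ℕ: if G is an n-vertex graph with minimum degree δ(G) ≥ (η+μ)n and α*(G) ≤ αn, then V(G) is (F, βn, t)-closed. -/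
open Finset

namespace RTT

lemma deg_of_acyclic {k : ℕ} (F : SimpleGraph (Fin k)) (hF : F.IsAcyclic) (s : Finset (Fin k))
    (hs : s.Nonempty) : ∃ l ∈ s, ∃ p, ∀ j ∈ s, F.Adj l j → j = p := by
  classical
  set H := F.induce (s : Set (Fin k)) with hH
  have hHa : H.IsAcyclic := hF.induce _
  have : Nonempty (s : Set (Fin k)) := ⟨⟨hs.choose, hs.choose_spec⟩⟩
  obtain ⟨u, v, p, hp, hmax⟩ := SimpleGraph.Walk.exists_isPath_forall_isPath_length_le_length H
  refine ⟨u.1, u.2, p.snd.1, fun j hj hadj => ?_⟩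
  have hadj' : H.Adj u ⟨j, hj⟩ := hadj
  have hmem : (⟨j, hj⟩ : (s : Set (Fin k))) ∈ p.support := by
    by_contra hn
    have := hmax _ _ (SimpleGraph.Walk.cons hadj'.symm p) (hp.cons hn)
    simp at this
  have := hHa.eq_snd_of_adj_start hp hadj' hmem
  rw [← this]

lemma deg_of_cycle {k : ℕ} (hk : 4 ≤ k) (s : Finset (Fin k))
    (hs : s.Nonempty) (h0 : (⟨0, by omega⟩ : Fin k) ∉ s) :
    ∃ l ∈ s, ∃ p, ∀ j ∈ s, (SimpleGraph.cycleGraph k).Adj l j → j = p := by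
  refine ⟨s.max' hs, s.max'_mem hs, ⟨(s.max' hs).1 - 1, by omega⟩, fun j hj hadj => ?_⟩
  have hle := s.le_max' j hj
  rw [SimpleGraph.cycleGraph_adj'] at hadj
  have hj0 : j.1 ≠ 0 := by
    intro h; apply h0; convert hj
    exact h.symm
  apply Fin.ext
  simp only
  generalize s.max' hs = M at hadj hle ⊢
  have hlev : j.1 ≤ M.1 := hle
  rcases hadj with h | h
  · rw [Fin.sub_val_of_le hle] at h; omega
  · rcases hle.lt_or_eq with h' | h'
    · rw [Fin.coe_sub_iff_lt.mpr h'] at h; have := M.2; omega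
    · subst h'; rw [Fin.sub_val_of_le le_rfl] at h; omega

/-- The common hypothesis on `F`. -/
def Nice {k : ℕ} (F : SimpleGraph (Fin k)) (q r : Fin k) : Prop :=
  q ≠ r ∧ ¬ F.Adj q r ∧ ∀ s : Finset (Fin k), s.Nonempty → q ∉ s →
    ∃ l ∈ s, ∃ p, ∀ j ∈ s, F.Adj l j → j = p

lemma nice_of {k : ℕ} (hk : 3 ≤ k) (F : SimpleGraph (Fin k))
    (h : F.IsTree ∨ (4 ≤ k ∧ F = SimpleGraph.cycleGraph k)) : ∃ q r, Nice F q r := by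
  rcases h with h | ⟨h4, rfl⟩
  · have hd := deg_of_acyclic F h.isAcyclic
    have : NeZero k := ⟨by omega⟩
    obtain ⟨l, -, p, hp⟩ := hd univ ⟨0, mem_univ _⟩
    have : ∃ r : Fin k, r ∉ ({l, p} : Finset (Fin k)) := by
      by_contra hcon
      push Not at hcon
      have h1 : (univ : Finset (Fin k)) ⊆ {l, p} := fun x _ => hcon x
      have h2 := card_le_card h1
      have h3 := Finset.card_le_two (a := l) (b := p)
      simp at h2; omega
    obtain ⟨r, hr⟩ := this
    simp at hr
    exact ⟨l, r, fun e => hr.1 e.symm, fun ha => hr.2 (hp r (mem_univ _) ha),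
      fun s hs _ => hd s hs⟩
  · refine ⟨⟨0, by omega⟩, ⟨2, by omega⟩, ?_, ?_, fun s hs h0 => deg_of_cycle h4 s hs h0⟩
    · intro h; simpa using congrArg Fin.val h
    · rw [SimpleGraph.cycleGraph_adj']
      rw [Fin.coe_sub_iff_lt.mpr (by simp [Fin.lt_def]), Fin.sub_val_of_le (by simp [Fin.le_def])]
      simp; omega

lemma embed {k n : ℕ} [Nonempty (Fin n)] (F : SimpleGraph (Fin k)) (G : SimpleGraph (Fin n))
    (m : ℕ) (hm : 1 ≤ m)
    (hole : ∀ U₁ U₂ : Finset (Fin n), Disjoint U₁ U₂ → U₁.card = m → U₂.card = m →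
      ∃ u ∈ U₁, ∃ v ∈ U₂, G.Adj u v)
    (q r : Fin k) (hF : Nice F q r) : ∀ (c : ℕ) (s : Finset (Fin k)), s.card = c → q ∉ s →
      ∀ V : Fin k → Finset (Fin n), (∀ i ∈ s, 2 * m * c ≤ (V i).card) →
      ∃ f : Fin k → Fin n, (∀ i ∈ s, f i ∈ V i) ∧ (∀ i ∈ s, ∀ j ∈ s, f i = f j → i = j) ∧
        ∀ i ∈ s, ∀ j ∈ s, F.Adj i j → G.Adj (f i) (f j) := by
  classical
  intro c
  induction c with
  | zero =>
    intro s hs hq V _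
    rw [card_eq_zero] at hs; subst hs
    exact ⟨fun _ => Classical.arbitrary _, by simp, by simp, by simp⟩
  | succ c ih =>
    intro s hs hq V hV
    obtain ⟨l, hl, p, hp⟩ := hF.2.2 s (card_pos.mp (by omega)) hq
    obtain ⟨A, hAV, hAm⟩ := exists_subset_card_eq (s := V l) (n := m) (by
      have := hV l hl; nlinarith)
    have hAne : A.Nonempty := card_pos.mp (by omega)
    have hsd : ∀ i ∈ s, 2 * m * c + m ≤ (V i \ A).card := by
      intro i hi
      have h1 := hV i hi
      have h2 := le_card_sdiff A (V i)
      have h3 : 2 * m * (c + 1) = 2 * m * c + 2 * m := by ring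
      omega
    obtain ⟨f, hf1, hf2, hf3⟩ := ih (s.erase l) (by rw [card_erase_of_mem hl]; omega)
      (fun h => hq (mem_of_mem_erase h))
      (fun i => if i = p then (V i \ A).filter (fun x => ∃ a ∈ A, G.Adj x a) else V i \ A) (by
        intro i hi
        have h1 := hsd i (mem_of_mem_erase hi)
        split_ifs with hip
        · have h2 := card_filter_add_card_filter_not (s := V i \ A) (fun x => ∃ a ∈ A, G.Adj x a)
          by_contra hcon
          have h3 : m ≤ ((V i \ A).filter (fun x => ¬ ∃ a ∈ A, G.Adj x a)).card := by omega
          obtain ⟨B, hB, hBm⟩ := exists_subset_card_eq h3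
          obtain ⟨u, hu, v, hv, huv⟩ := hole B A (by
            rw [disjoint_left]; intro x hx
            have := hB hx; simp at this; exact this.1.2) hBm hAm
          have := hB hu
          simp only [mem_filter] at this
          exact this.2 ⟨v, hv, huv⟩
        · omega)
    have hfA : ∀ i ∈ s.erase l, f i ∈ V i \ A := by
      intro i hi
      have := hf1 i hi
      split_ifs at this with hip
      · exact (mem_filter.mp this).1
      · exact this
    obtain ⟨a, haA, ha⟩ : ∃ a ∈ A, (p ∈ s.erase l → G.Adj (f p) a) := by
      by_cases hps : p ∈ s.erase l
      · have := hf1 p hps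
        simp only [if_true, mem_filter] at this
        obtain ⟨a, haA, ha⟩ := this.2
        exact ⟨a, haA, fun _ => ha⟩
      · exact ⟨hAne.choose, hAne.choose_spec, fun h => absurd h hps⟩
    have hne : ∀ i ∈ s, i ≠ l → f i ≠ a := by
      intro i hi hil e
      have := hfA i (mem_erase.mpr ⟨hil, hi⟩)
      rw [e] at this
      exact (mem_sdiff.mp this).2 haA
    have hadj : ∀ j ∈ s, F.Adj l j → G.Adj (f j) a := by
      intro j hj hlj
      have := hp j hj hlj
      subst this
      exact ha (mem_erase.mpr ⟨hlj.ne', hj⟩)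
    refine ⟨Function.update f l a, ?_, ?_, ?_⟩
    · intro i hi
      by_cases hil : i = l
      · subst hil; simpa using hAV haA
      · rw [Function.update_of_ne hil]
        exact (mem_sdiff.mp (hfA i (mem_erase.mpr ⟨hil, hi⟩))).1
    · intro i hi j hj hij
      by_cases hil : i = l <;> by_cases hjl : j = l
      · rw [hil, hjl]
      · subst hil; rw [Function.update_self, Function.update_of_ne hjl] at hij
        exact absurd hij.symm (hne j hj hjl)
      · subst hjl; rw [Function.update_self, Function.update_of_ne hil] at hij
        exact absurd hij (hne i hi hil)
      · rw [Function.update_of_ne hil, Function.update_of_ne hjl] at hij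
        exact hf2 i (mem_erase.mpr ⟨hil, hi⟩) j (mem_erase.mpr ⟨hjl, hj⟩) hij
    · intro i hi j hj hij
      by_cases hil : i = l <;> by_cases hjl : j = l
      · rw [hil, hjl] at hij; exact absurd hij (F.loopless.irrefl _)
      · subst hil; rw [Function.update_self, Function.update_of_ne hjl]
        exact (hadj j hj hij).symm
      · subst hjl; rw [Function.update_self, Function.update_of_ne hil]
        exact hadj i hi hij.symm
      · rw [Function.update_of_ne hil, Function.update_of_ne hjl]
        exact hf3 i (mem_erase.mpr ⟨hil, hi⟩) j (mem_erase.mpr ⟨hjl, hj⟩) hij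

/-- `F` can be embedded with `q ↦ w` and other vertices in prescribed large sets. -/
lemma embedF {k n : ℕ} [Nonempty (Fin n)] (F : SimpleGraph (Fin k)) (G : SimpleGraph (Fin n))
    (m : ℕ) (hm : 1 ≤ m)
    (hole : ∀ U₁ U₂ : Finset (Fin n), Disjoint U₁ U₂ → U₁.card = m → U₂.card = m →
      ∃ u ∈ U₁, ∃ v ∈ U₂, G.Adj u v)
    (q r : Fin k) (hF : Nice F q r) (V : Fin k → Finset (Fin n)) (w : Fin n)
    (Z : Finset (Fin n)) (hV : ∀ i, i ≠ q → 2 * m * k + Z.card + 1 ≤ (V i).card)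
    (hadj : ∀ i, F.Adj q i → ∀ x ∈ V i, G.Adj w x) :
    ∃ f : Fin k → Fin n, Function.Injective f ∧ (∀ a b, F.Adj a b → G.Adj (f a) (f b)) ∧
      f q = w ∧ ∀ i, i ≠ q → f i ∈ V i ∧ f i ∉ Z := by
  classical
  have hc : (univ.erase q).card ≤ k := by simp
  obtain ⟨f, hf1, hf2, hf3⟩ := embed F G m hm hole q r hF _ (univ.erase q) rfl (by simp)
    (fun i => V i \ insert w Z) (by
      intro i hi
      have h1 := hV i (ne_of_mem_erase hi)
      have h2 := le_card_sdiff (insert w Z) (V i)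
      have h3 := card_insert_le w Z
      have h4 : 2 * m * (univ.erase q).card ≤ 2 * m * k := Nat.mul_le_mul_left _ hc
      omega)
  have hm' : ∀ i, i ≠ q → i ∈ univ.erase q := fun i hi => by simp [hi]
  have hf1' : ∀ i, i ≠ q → f i ∈ V i ∧ f i ≠ w ∧ f i ∉ Z := by
    intro i hi
    have := hf1 i (hm' i hi)
    simpa using this
  refine ⟨Function.update f q w, ?_, ?_, by simp, ?_⟩
  · intro i j hij
    by_cases hil : i = q <;> by_cases hjl : j = q
    · rw [hil, hjl]
    · subst hil; rw [Function.update_self, Function.update_of_ne hjl] at hij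
      exact absurd hij.symm (hf1' j hjl).2.1
    · subst hjl; rw [Function.update_self, Function.update_of_ne hil] at hij
      exact absurd hij (hf1' i hil).2.1
    · rw [Function.update_of_ne hil, Function.update_of_ne hjl] at hij
      exact hf2 i (hm' i hil) j (hm' j hjl) hij
  · intro i j hij
    by_cases hil : i = q <;> by_cases hjl : j = q
    · rw [hil, hjl] at hij; exact absurd hij (F.loopless.irrefl _)
    · subst hil; rw [Function.update_self, Function.update_of_ne hjl]
      exact hadj j hij _ (hf1' j hjl).1
    · subst hjl; rw [Function.update_self, Function.update_of_ne hil]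
      exact (hadj i hij.symm _ (hf1' i hil).1).symm
    · rw [Function.update_of_ne hil, Function.update_of_ne hjl]
      exact hf3 i (hm' i hil) j (hm' j hjl) hij
  · intro i hi
    rw [Function.update_of_ne hi]
    exact ⟨(hf1' i hi).1, (hf1' i hi).2.2⟩

open Classical in
/-- Common neighbourhood. -/
noncomputable def cn {n : ℕ} (G : SimpleGraph (Fin n)) (x y : Fin n) : Finset (Fin n) :=
  univ.filter (fun z => G.Adj x z ∧ G.Adj y z)

lemma connector {k n : ℕ} [Nonempty (Fin n)] (F : SimpleGraph (Fin k)) (G : SimpleGraph (Fin n))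
    (m : ℕ) (hm : 1 ≤ m)
    (hole : ∀ U₁ U₂ : Finset (Fin n), Disjoint U₁ U₂ → U₁.card = m → U₂.card = m →
      ∃ u ∈ U₁, ∃ v ∈ U₂, G.Adj u v)
    (q r : Fin k) (hF : Nice F q r) (x y : Fin n)
    (Z : Finset (Fin n)) (hy : y ∈ Z)
    (hV : 2 * m * k + Z.card + 1 ≤ (cn G x y).card) :
    ∃ S : Finset (Fin n), Disjoint S Z ∧ S.card ≤ k ∧
      SpansCopy F G (insert x S) ∧ SpansCopy F G (insert y S) := by
  classical
  obtain ⟨f, hinj, hhom, hq, hf⟩ := embedF F G m hm hole q r hF (fun _ => cn G x y) x Z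
    (fun _ _ => hV) (fun i _ z hz => (mem_filter.mp hz).2.1)
  have him : ∀ g : Fin k → Fin n, (∀ i, i ≠ q → g i = f i) →
      image g univ = insert (g q) (image f (univ.erase q)) := by
    intro g hg
    ext z
    simp only [mem_image, mem_univ, true_and, mem_insert, mem_erase, and_true]
    constructor
    · rintro ⟨i, rfl⟩
      by_cases h : i = q
      · left; rw [h]
      · right; exact ⟨i, h, (hg i h).symm⟩
    · rintro (rfl | ⟨i, hi, rfl⟩)
      · exact ⟨q, rfl⟩
      · exact ⟨i, hg i hi⟩
  refine ⟨image f (univ.erase q), ?_, ?_, ?_, ?_⟩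
  · rw [disjoint_left]
    intro z hz
    obtain ⟨i, hi, rfl⟩ := mem_image.mp hz
    exact (hf i (ne_of_mem_erase hi)).2
  · refine card_image_le.trans ?_
    simp
  · exact ⟨f, hinj, hhom, by rw [him f (fun _ _ => rfl), hq]⟩
  · refine ⟨Function.update f q y, ?_, ?_, ?_⟩
    · intro i j hij
      by_cases hil : i = q <;> by_cases hjl : j = q
      · rw [hil, hjl]
      · subst hil; rw [Function.update_self, Function.update_of_ne hjl] at hij
        exact absurd (hij ▸ hy) (hf j hjl).2
      · subst hjl; rw [Function.update_self, Function.update_of_ne hil] at hij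
        exact absurd (hij ▸ hy) (hf i hil).2
      · rw [Function.update_of_ne hil, Function.update_of_ne hjl] at hij
        exact hinj hij
    · intro i j hij
      by_cases hil : i = q <;> by_cases hjl : j = q
      · rw [hil, hjl] at hij; exact absurd hij (F.loopless.irrefl _)
      · subst hil; rw [Function.update_self, Function.update_of_ne hjl]
        exact (mem_filter.mp (hf j hjl).1).2.2
      · subst hjl; rw [Function.update_self, Function.update_of_ne hil]
        exact (mem_filter.mp (hf i hil).1).2.2.symm
      · rw [Function.update_of_ne hil, Function.update_of_ne hjl]
        exact hhom i j hij
    · rw [him _ (fun i hi => Function.update_of_ne hi _ _), Function.update_self]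

lemma connectors {k n : ℕ} [Nonempty (Fin n)] (F : SimpleGraph (Fin k)) (G : SimpleGraph (Fin n))
    (m : ℕ) (hm : 1 ≤ m)
    (hole : ∀ U₁ U₂ : Finset (Fin n), Disjoint U₁ U₂ → U₁.card = m → U₂.card = m →
      ∃ u ∈ U₁, ∃ v ∈ U₂, G.Adj u v)
    (q r : Fin k) (hF : Nice F q r) (y z : Fin k → Fin n)
    (Z : Finset (Fin n)) (hz : ∀ i, z i ∈ Z)
    (hV : ∀ i, 2 * m * k + Z.card + k * k + 1 ≤ (cn G (y i) (z i)).card) (s : Finset (Fin k)) :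
    ∃ C : Fin k → Finset (Fin n), (∀ i, Disjoint (C i) Z) ∧ (∀ i, (C i).card ≤ k) ∧
      (∀ i ∈ s, SpansCopy F G (insert (y i) (C i)) ∧ SpansCopy F G (insert (z i) (C i))) ∧
      ∀ i j, i ≠ j → Disjoint (C i) (C j) := by
  classical
  induction s using Finset.induction_on with
  | empty => exact ⟨fun _ => ∅, by simp, by simp, by simp, by simp⟩
  | insert a s ha ih =>
    obtain ⟨C, h1, h2, h3, h4⟩ := ih
    obtain ⟨S, hS1, hS2, hS3, hS4⟩ := connector F G m hm hole q r hF (y a) (z a)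
      (Z ∪ univ.biUnion C) (mem_union_left _ (hz a)) (by
        have e1 := card_union_le Z (univ.biUnion C)
        have e2 : (univ.biUnion C).card ≤ (univ : Finset (Fin k)).card * k :=
          card_biUnion_le_card_mul _ _ _ (fun i _ => h2 i)
        rw [card_univ, Fintype.card_fin] at e2
        have := hV a
        omega)
    rw [disjoint_union_right] at hS1
    have hSC : ∀ i, Disjoint S (C i) := fun i =>
      hS1.2.mono_right (subset_biUnion_of_mem C (mem_univ i))
    refine ⟨Function.update C a S, ?_, ?_, ?_, ?_⟩
    · intro i
      by_cases h : i = a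
      · subst h; simpa using hS1.1
      · simpa [h] using h1 i
    · intro i
      by_cases h : i = a
      · subst h; simpa using hS2
      · simpa [h] using h2 i
    · intro i hi
      by_cases h : i = a
      · subst h; simpa using ⟨hS3, hS4⟩
      · simpa [h] using h3 i (mem_of_mem_insert_of_ne hi h)
    · intro i j hij
      by_cases h : i = a <;> by_cases h' : j = a
      · exact absurd (h.trans h'.symm) hij
      · subst h; simpa [h'] using hSC j
      · subst h'; simpa [h] using (hSC i).symm
      · simpa [h, h'] using h4 i j hij

lemma tiling_aux {k n : ℕ} (F : SimpleGraph (Fin k)) (G : SimpleGraph (Fin n))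
    (A : Finset (Fin n)) (B : Fin k → Finset (Fin n)) (hA : SpansCopy F G A)
    (hB : ∀ i, SpansCopy F G (B i)) (hAB : ∀ i, Disjoint A (B i))
    (hBB : ∀ i j, i ≠ j → Disjoint (B i) (B j)) :
    PerfTilingOn F G (A ∪ univ.biUnion B) := by
  classical
  refine ⟨insert A (image B univ), ⟨?_, ?_⟩, ?_⟩
  · intro S hS
    rcases mem_insert.mp hS with rfl | hS
    · exact hA
    · obtain ⟨i, -, rfl⟩ := mem_image.mp hS
      exact hB i
  · intro S hS S' hS' hne
    rcases mem_insert.mp hS with h1 | hS <;> rcases mem_insert.mp hS' with h2 | hS'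
    · exact absurd (h1.trans h2.symm) hne
    · obtain ⟨i, -, rfl⟩ := mem_image.mp hS'
      rw [h1]; exact hAB i
    · obtain ⟨i, -, rfl⟩ := mem_image.mp hS
      rw [h2]
      exact (hAB i).symm
    · obtain ⟨i, -, rfl⟩ := mem_image.mp hS
      obtain ⟨j, -, rfl⟩ := mem_image.mp hS'
      exact hBB i j (fun h => hne (by rw [h]))
  · ext x; simp

end RTT

namespace RTT

open Classical in
/-- Neighbourhood. -/
noncomputable def nb {n : ℕ} (G : SimpleGraph (Fin n)) (x : Fin n) : Finset (Fin n) :=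
  univ.filter (fun z => G.Adj x z)

open Classical in
/-- Vertices with many common neighbours with `x`. -/
noncomputable def cl {n : ℕ} (G : SimpleGraph (Fin n)) (c : ℝ) (x : Fin n) : Finset (Fin n) :=
  univ.filter (fun y => c ≤ ((cn G x y).card : ℝ))

lemma nb_card {n : ℕ} (G : SimpleGraph (Fin n)) (d : ℝ) (h : MinDegGE G d) (x : Fin n) :
    d ≤ ((nb G x).card : ℝ) := by
  have h1 := h x
  have h2 : G.neighborSet x = (nb G x : Set (Fin n)) := by
    ext z; simp [nb]
  rwa [h2, Set.ncard_coe_finset] at h1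

open Classical in
lemma markov {ι : Type*} (t : Finset ι) (g : ι → ℝ) (N c : ℝ) (hc : 0 ≤ c)
    (hN : ∀ i ∈ t, g i ≤ N) :
    ∑ i ∈ t, g i ≤ ((t.filter (fun i => c ≤ g i)).card : ℝ) * N + (t.card : ℝ) * c := by
  have h : ∀ i ∈ t, g i ≤ (if c ≤ g i then N else 0) + c := by
    intro i hi
    split_ifs with h
    · linarith [hN i hi]
    · linarith
  refine (sum_le_sum h).trans ?_
  rw [sum_add_distrib, ← sum_filter, sum_const, sum_const, nsmul_eq_mul, nsmul_eq_mul]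

lemma card_le_n {n : ℕ} (s : Finset (Fin n)) : (s.card : ℝ) ≤ n := by
  have := card_le_univ s
  rw [Fintype.card_fin] at this
  exact_mod_cast this

lemma cl_card {n : ℕ} (G : SimpleGraph (Fin n)) (d c : ℝ) (hd : 0 ≤ d) (hc : 0 ≤ c)
    (h : ∀ x, d ≤ ((nb G x).card : ℝ)) (x : Fin n) :
    d * d ≤ ((cl G c x).card : ℝ) * n + n * c := by
  classical
  have h1 := markov (univ : Finset (Fin n)) (fun y => ((cn G x y).card : ℝ)) n c hc
    (fun _ _ => card_le_n _)
  have h2 : ∑ y : Fin n, ((cn G x y).card : ℝ) = ∑ z ∈ nb G x, ((nb G z).card : ℝ) := by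
    simp only [cn, nb, card_filter, sum_filter]
    push_cast
    rw [sum_comm]
    refine sum_congr rfl fun z _ => ?_
    split_ifs with hz
    · simp [hz, G.adj_comm]
    · simp [hz]
  have h3 : d * d ≤ ∑ z ∈ nb G x, ((nb G z).card : ℝ) := by
    calc d * d ≤ ((nb G x).card : ℝ) * d := mul_le_mul_of_nonneg_right (h x) hd
      _ = ∑ z ∈ nb G x, d := by simp
      _ ≤ _ := sum_le_sum fun z _ => h z
  rw [h2] at h1
  rw [card_univ, Fintype.card_fin] at h1
  refine h3.trans (h1.trans (le_of_eq ?_))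
  simp only [cl]

open Classical in
/-- Vertices in `N(q)` with many close vertices in `N(q)`. -/
noncomputable def X {n : ℕ} (G : SimpleGraph (Fin n)) (c : ℝ) (q : Fin n) : Finset (Fin n) :=
  (nb G q).filter (fun x => c ≤ ((nb G q ∩ cl G c x).card : ℝ))

lemma exists_q {n : ℕ} (G : SimpleGraph (Fin n)) (η : ℝ) (hη : 0 < η) (hn : 0 < n)
    (h : ∀ x, η * n ≤ ((nb G x).card : ℝ)) (W : Finset (Fin n)) (hW : (W.card : ℝ) ≤ 1 / 4 * n) :
    ∃ q, q ∉ W ∧ η ^ 2 / 4 * n ≤ ((X G (η ^ 2 / 4 * n) q).card : ℝ) := by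
  classical
  by_contra hcon
  push Not at hcon
  set c := η ^ 2 / 4 * n with hcdef
  have hn' : (0 : ℝ) < n := by exact_mod_cast hn
  have hc : 0 ≤ c := by positivity
  have h1 : ∀ q, q ∉ W → η ^ 2 / 2 * n ^ 2 ≤ ∑ x ∈ nb G q, ((nb G q \ cl G c x).card : ℝ) := by
    intro q hq
    have e1 := markov (nb G q) (fun x => ((nb G q ∩ cl G c x).card : ℝ)) n c hc
      (fun _ _ => card_le_n _)
    have e2 := hcon q hq
    have e3 : ∑ x ∈ nb G q, ((nb G q \ cl G c x).card : ℝ)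
        + ∑ x ∈ nb G q, ((nb G q ∩ cl G c x).card : ℝ)
        = ((nb G q).card : ℝ) * ((nb G q).card : ℝ) := by
      rw [← sum_add_distrib, ← nsmul_eq_mul, ← sum_const]
      refine sum_congr rfl fun x _ => ?_
      exact_mod_cast card_sdiff_add_card_inter _ _
    have e4 : ((nb G q).card : ℝ) * c ≤ n * c := mul_le_mul_of_nonneg_right (card_le_n _) hc
    have e5 : (η * n) * (η * n) ≤ ((nb G q).card : ℝ) * ((nb G q).card : ℝ) :=
      mul_self_le_mul_self (by positivity) (h q)
    have e6 : ((X G c q).card : ℝ) * n ≤ c * n := mul_le_mul_of_nonneg_right e2.le hn'.le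
    have e7 : c * n = η ^ 2 / 4 * n ^ 2 := by rw [hcdef]; ring
    have e8 : ((X G c q).card : ℝ) =
      ((filter (fun x => c ≤ ((nb G q ∩ cl G c x).card : ℝ)) (nb G q)).card : ℝ) := by
      simp only [X]
    rw [← e8] at e1
    nlinarith
  have h2 : ∑ q : Fin n, ∑ x ∈ nb G q, ((nb G q \ cl G c x).card : ℝ)
      = ∑ x : Fin n, ∑ y : Fin n, if c ≤ ((cn G x y).card : ℝ) then 0
          else ((cn G x y).card : ℝ) := by
    have e1 : ∀ q x, ((nb G q \ cl G c x).card : ℝ) = ∑ y : Fin n,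
        if G.Adj q y ∧ ¬ c ≤ ((cn G x y).card : ℝ) then 1 else 0 := by
      intro q x
      rw [← natCast_card_filter]
      congr 2
      ext y; simp [nb, cl]
    have e2 : ∀ x y, ((cn G x y).card : ℝ) = ∑ q : Fin n,
        if G.Adj q x ∧ G.Adj q y then 1 else 0 := by
      intro x y
      rw [← natCast_card_filter]
      congr 2
      ext q; simp [cn, G.adj_comm]
    simp_rw [e1]
    have e3 : ∀ q, ∑ x ∈ nb G q, ∑ y : Fin n,
        (if G.Adj q y ∧ ¬ c ≤ ((cn G x y).card : ℝ) then (1 : ℝ) else 0)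
        = ∑ x : Fin n, ∑ y : Fin n,
        (if (G.Adj q x ∧ G.Adj q y) ∧ ¬ c ≤ ((cn G x y).card : ℝ) then (1 : ℝ) else 0) := by
      intro q
      rw [nb, sum_filter]
      refine sum_congr rfl fun x _ => ?_
      split_ifs with hx
      · simp [hx]
      · simp [hx]
    simp_rw [e3]
    rw [sum_comm]
    refine sum_congr rfl fun x _ => ?_
    rw [sum_comm]
    refine sum_congr rfl fun y _ => ?_
    split_ifs with hxy
    · simp [hxy]
    · refine Eq.trans (sum_congr rfl fun q _ => ?_) (e2 x y).symm
      simp only [hxy, not_false_eq_true, and_true]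
  have h3 : ∑ x : Fin n, ∑ y : Fin n, (if c ≤ ((cn G x y).card : ℝ) then 0
          else ((cn G x y).card : ℝ)) ≤ n * (n * c) := by
    have : ∀ x : Fin n, ∑ y : Fin n, (if c ≤ ((cn G x y).card : ℝ) then 0
          else ((cn G x y).card : ℝ)) ≤ n * c := by
      intro x
      calc _ ≤ ∑ y : Fin n, c := sum_le_sum fun y _ => by
            split_ifs with hh
            · exact hc
            · linarith
        _ = _ := by simp
    calc _ ≤ ∑ x : Fin n, (n * c) := sum_le_sum fun x _ => this x
      _ = _ := by simp
  have h4 : ((univ \ W).card : ℝ) * (η ^ 2 / 2 * n ^ 2) ≤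
      ∑ q : Fin n, ∑ x ∈ nb G q, ((nb G q \ cl G c x).card : ℝ) := by
    calc _ = ∑ q ∈ univ \ W, (η ^ 2 / 2 * (n : ℝ) ^ 2) := by rw [sum_const, nsmul_eq_mul]
      _ ≤ ∑ q ∈ univ \ W, ∑ x ∈ nb G q, ((nb G q \ cl G c x).card : ℝ) :=
          sum_le_sum fun q hq => h1 q (mem_sdiff.mp hq).2
      _ ≤ _ := sum_le_sum_of_subset_of_nonneg (subset_univ _)
          (fun q _ _ => sum_nonneg fun x _ => Nat.cast_nonneg _)
  have h5 : 3 / 4 * (n : ℝ) ≤ ((univ \ W).card : ℝ) := by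
    have := card_sdiff_add_card_inter univ W
    rw [univ_inter, card_univ, Fintype.card_fin] at this
    have h' : ((univ \ W).card : ℝ) + W.card = n := by exact_mod_cast this
    linarith
  have h6 := mul_le_mul_of_nonneg_right h5 (show 0 ≤ η ^ 2 / 2 * (n : ℝ) ^ 2 by positivity)
  have h7 : (n : ℝ) * (n * c) = η ^ 2 / 4 * n ^ 3 := by rw [hcdef]; ring
  have h8 : 0 < η ^ 2 * (n : ℝ) ^ 3 := by positivity
  rw [h2] at h4
  nlinarith

end RTT

namespace RTT

lemma reach_main {k n : ℕ} [Nonempty (Fin n)] (F : SimpleGraph (Fin k)) (G : SimpleGraph (Fin n))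
    (m : ℕ) (hm : 1 ≤ m) (hk : 3 ≤ k)
    (hole : ∀ U₁ U₂ : Finset (Fin n), Disjoint U₁ U₂ → U₁.card = m → U₂.card = m →
      ∃ u ∈ U₁, ∃ v ∈ U₂, G.Adj u v)
    (q r : Fin k) (hF : Nice F q r) (c : ℝ) (u v : Fin n) (huv : u ≠ v) (W : Finset (Fin n))
    (hc : ((2 * m * k + W.card + 5 * (k * k) : ℕ) : ℝ) ≤ c)
    (hcl : ∀ x, c ≤ ((cl G c x).card : ℝ))
    (w : Fin n) (hw : w ∉ insert u (insert v W)) (hX : c ≤ ((X G c w).card : ℝ)) :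
    ∃ S : Finset (Fin n), Disjoint S W ∧ u ∉ S ∧ v ∉ S ∧ S.card ≤ k * (k + 2) - 1 ∧
      PerfTilingOn F G (insert u S) ∧ PerfTilingOn F G (insert v S) := by
  classical
  have hkk : 3 * k ≤ k * k := Nat.mul_le_mul_right k hk
  have lift : ∀ A : Finset (Fin n), c ≤ (A.card : ℝ) →
      2 * m * k + W.card + 5 * (k * k) ≤ A.card := by
    intro A hA
    exact_mod_cast hc.trans hA
  set Z₀ := insert u (insert v W) with hZ₀
  have hZ₀c : Z₀.card ≤ W.card + 2 := by
    have h1 := card_insert_le u (insert v W)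
    have h2 := card_insert_le v W
    rw [← hZ₀] at h1
    omega
  obtain ⟨f, finj, fhom, fq, hf⟩ := embedF F G m hm hole q r hF
    (fun i => if F.Adj q i then X G c w else cl G c u) w Z₀ (by
      intro i _
      split_ifs
      · have := lift _ hX; omega
      · have := lift _ (hcl u); omega) (by
      intro i hi x hx
      rw [if_pos hi] at hx
      exact (mem_filter.mp (mem_filter.mp hx).1).2)
  have hfr : f r ∈ cl G c u := by
    have := (hf r hF.1.symm).1
    rwa [if_neg hF.2.1] at this
  have hfX : ∀ i, F.Adj q i → c ≤ ((nb G w ∩ cl G c (f i)).card : ℝ) := by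
    intro i hi
    have := (hf i hi.ne').1
    rw [if_pos hi] at this
    exact (mem_filter.mp this).2
  obtain ⟨g, ginj, ghom, gq, hg⟩ := embedF F G m hm hole q r hF
    (fun i => if F.Adj q i then nb G w ∩ cl G c (f i) else if i = r then cl G c v
      else cl G c (f i)) w (Z₀ ∪ image f univ) (by
      intro i _
      have h1 := card_union_le Z₀ (image f univ)
      have h2 : (image f univ).card ≤ k := card_image_le.trans (by simp)
      split_ifs with h h'
      · have := lift _ (hfX i h); omega
      · have := lift _ (hcl v); omega
      · have := lift _ (hcl (f i)); omega) (by
      intro i hi x hx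
      rw [if_pos hi] at hx
      have := (mem_inter.mp hx).1
      exact (mem_filter.mp this).2)
  have hgr : g r ∈ cl G c v := by
    have := (hg r hF.1.symm).1
    rwa [if_neg hF.2.1, if_pos rfl] at this
  have hgi : ∀ i, i ≠ q → i ≠ r → g i ∈ cl G c (f i) := by
    intro i hi hir
    have := (hg i hi).1
    by_cases h : F.Adj q i
    · rw [if_pos h] at this; exact (mem_inter.mp this).2
    · rwa [if_neg h, if_neg hir] at this
  have hf0 : ∀ i, f i ∉ Z₀ := by
    intro i
    by_cases h : i = q
    · rw [h, fq]; exact hw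
    · exact (hf i h).2
  have hg0 : ∀ i, g i ∉ Z₀ := by
    intro i
    by_cases h : i = q
    · rw [h, gq]; exact hw
    · exact fun h' => (hg i h).2 (mem_union_left _ h')
  have hgf : ∀ i, i ≠ q → ∀ j, g i ≠ f j := by
    intro i hi j e
    exact (hg i hi).2 (mem_union_right _ (mem_image.mpr ⟨j, mem_univ _, e.symm⟩))
  have huf : ∀ i, f i ≠ u ∧ f i ≠ v ∧ f i ∉ W := by
    intro i; have := hf0 i; simpa [hZ₀] using this
  have hug : ∀ i, g i ≠ u ∧ g i ≠ v ∧ g i ∉ W := by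
    intro i; have := hg0 i; simpa [hZ₀] using this
  -- the pairs
  set y : Fin k → Fin n := fun i => if i = q then g r else if i = r then u else g i with hy
  set z : Fin k → Fin n := fun i => if i = q then v else f i with hz
  have hqr : q ≠ r := hF.1
  have yq : y q = g r := by simp [hy]
  have yr : y r = u := by simp [hy, hqr.symm]
  have yi : ∀ i, i ≠ q → i ≠ r → y i = g i := by intro i h1 h2; simp [hy, h1, h2]
  have zq : z q = v := by simp [hz]
  have zi : ∀ i, i ≠ q → z i = f i := by intro i h1; simp [hz, h1]
  have cncomm : ∀ a b, cn G a b = cn G b a := by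
    intro a b; simp only [cn]; congr 1; ext t; exact and_comm
  have hcn : ∀ i, c ≤ ((cn G (y i) (z i)).card : ℝ) := by
    intro i
    by_cases h1 : i = q
    · rw [h1, yq, zq, cncomm]; exact (mem_filter.mp hgr).2
    · by_cases h2 : i = r
      · rw [h2, yr, zi r hqr.symm]; exact (mem_filter.mp hfr).2
      · rw [yi i h1 h2, zi i h1, cncomm]; exact (mem_filter.mp (hgi i h1 h2)).2
  set Z := Z₀ ∪ image f univ ∪ image g univ with hZ
  have hyZ : ∀ i, y i ∈ Z := by
    intro i
    by_cases h1 : i = q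
    · rw [h1, yq]; simp [hZ]
    · by_cases h2 : i = r
      · rw [h2, yr]; simp [hZ, hZ₀]
      · rw [yi i h1 h2]; simp [hZ]
  have hzZ : ∀ i, z i ∈ Z := by
    intro i
    by_cases h1 : i = q
    · rw [h1, zq]; simp [hZ, hZ₀]
    · rw [zi i h1]; simp [hZ]
  have hfc : (image f univ).card ≤ k := card_image_le.trans (by simp)
  have hgc : (image g univ).card ≤ k := card_image_le.trans (by simp)
  obtain ⟨C, hC1, hC2, hC3, hC4⟩ := connectors F G m hm hole q r hF y z Z hzZ (by
    intro i
    have h1 := card_union_le (Z₀ ∪ image f univ) (image g univ)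
    have h2 := card_union_le Z₀ (image f univ)
    have := lift _ (hcn i)
    rw [← hZ] at h1
    omega) univ
  have hCn : ∀ a ∈ Z, ∀ i, a ∉ C i := fun a ha i h => disjoint_left.mp (hC1 i) h ha
  have yinj : ∀ i j, y i = y j → i = j := by
    intro i j hij
    by_cases h1 : i = q <;> by_cases h2 : j = q
    · rw [h1, h2]
    · exfalso
      rw [h1, yq] at hij
      by_cases h3 : j = r
      · rw [h3, yr] at hij; exact (hug r).1 hij
      · rw [yi j h2 h3] at hij; exact h3 (ginj hij).symm
    · exfalso
      rw [h2, yq] at hij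
      by_cases h3 : i = r
      · rw [h3, yr] at hij; exact (hug r).1 hij.symm
      · rw [yi i h1 h3] at hij; exact h3 (ginj hij)
    · by_cases h3 : i = r <;> by_cases h4 : j = r
      · rw [h3, h4]
      · rw [h3, yr, yi j h2 h4] at hij; exact absurd hij.symm (hug j).1
      · rw [h4, yr, yi i h1 h3] at hij; exact absurd hij (hug i).1
      · rw [yi i h1 h3, yi j h2 h4] at hij; exact ginj hij
  have zinj : ∀ i j, z i = z j → i = j := by
    intro i j hij
    by_cases h1 : i = q <;> by_cases h2 : j = q
    · rw [h1, h2]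
    · rw [h1, zq, zi j h2] at hij; exact absurd hij.symm (huf j).2.1
    · rw [h2, zq, zi i h1] at hij; exact absurd hij (huf i).2.1
    · rw [zi i h1, zi j h2] at hij; exact finj hij
  have hyf : ∀ i j, y i ≠ f j := by
    intro i j
    by_cases h1 : i = q
    · rw [h1, yq]; exact hgf r hqr.symm j
    · by_cases h2 : i = r
      · rw [h2, yr]; exact (huf j).1.symm
      · rw [yi i h1 h2]; exact hgf i h1 j
  have hzg : ∀ i j, z i ≠ g j := by
    intro i j
    by_cases h1 : i = q
    · rw [h1, zq]; exact (hug j).2.1.symm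
    · rw [zi i h1]
      by_cases h2 : j = q
      · rw [h2, gq, ← fq]; exact fun e => h1 (finj e)
      · exact (hgf j h2 i).symm
  have tile : ∀ (φ x : Fin k → Fin n), Function.Injective φ →
      (∀ a b, F.Adj a b → G.Adj (φ a) (φ b)) → (∀ i, φ i ∈ Z) → (∀ i, x i ∈ Z) →
      (∀ i j, x i = x j → i = j) → (∀ i j, x i ≠ φ j) →
      (∀ i, SpansCopy F G (insert (x i) (C i))) →
      PerfTilingOn F G (image φ univ ∪ univ.biUnion (fun i => insert (x i) (C i))) := by
    intro φ x h1 h2 h3 h4 h5 h6 h7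
    refine tiling_aux F G _ _ ⟨φ, h1, h2, rfl⟩ h7 ?_ ?_
    · intro i
      rw [disjoint_left]
      intro a ha hb
      obtain ⟨j, -, rfl⟩ := mem_image.mp ha
      rcases mem_insert.mp hb with e | hb
      · exact h6 i j e.symm
      · exact hCn _ (h3 j) i hb
    · intro i j hij
      rw [disjoint_insert_left, disjoint_insert_right]
      refine ⟨?_, hCn _ (h4 j) i, hC4 i j hij⟩
      rw [mem_insert]
      rintro (e | e)
      · exact hij (h5 i j e)
      · exact hCn _ (h4 i) j e
  have hfZ : ∀ i, f i ∈ Z := by intro i; simp [hZ]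
  have hgZ : ∀ i, g i ∈ Z := by intro i; simp [hZ]
  have t1 := tile f y finj fhom hfZ hyZ yinj hyf (fun i => (hC3 i (mem_univ i)).1)
  have t2 := tile g z ginj ghom hgZ hzZ zinj hzg (fun i => (hC3 i (mem_univ i)).2)
  set S := (image f univ ∪ (image g univ).erase w) ∪ univ.biUnion C with hS
  have huZ : u ∈ Z := by simp [hZ, hZ₀]
  have hvZ : v ∈ Z := by simp [hZ, hZ₀]
  have hwf : ∀ i, f i = w → i = q := fun i h => finj (h.trans fq.symm)
  have hwg : ∀ i, g i = w → i = q := fun i h => ginj (h.trans gq.symm)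
  refine ⟨S, ?_, ?_, ?_, ?_, ?_, ?_⟩
  · rw [disjoint_left]
    intro a ha haW
    rw [hS, mem_union, mem_union] at ha
    rcases ha with (ha | ha) | ha
    · obtain ⟨i, -, rfl⟩ := mem_image.mp ha; exact (huf i).2.2 haW
    · obtain ⟨i, -, rfl⟩ := mem_image.mp (mem_of_mem_erase ha); exact (hug i).2.2 haW
    · obtain ⟨i, -, hi⟩ := mem_biUnion.mp ha
      exact hCn a (by simp [hZ, hZ₀, haW]) i hi
  · intro ha
    rw [hS, mem_union, mem_union] at ha
    rcases ha with (ha | ha) | ha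
    · obtain ⟨i, -, e⟩ := mem_image.mp ha; exact (huf i).1 e
    · obtain ⟨i, -, e⟩ := mem_image.mp (mem_of_mem_erase ha); exact (hug i).1 e
    · obtain ⟨i, -, hi⟩ := mem_biUnion.mp ha
      exact hCn _ huZ i hi
  · intro ha
    rw [hS, mem_union, mem_union] at ha
    rcases ha with (ha | ha) | ha
    · obtain ⟨i, -, e⟩ := mem_image.mp ha; exact (huf i).2.1 e
    · obtain ⟨i, -, e⟩ := mem_image.mp (mem_of_mem_erase ha); exact (hug i).2.1 e
    · obtain ⟨i, -, hi⟩ := mem_biUnion.mp ha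
      exact hCn _ hvZ i hi
  · have e1 := card_union_le (image f univ ∪ (image g univ).erase w) (univ.biUnion C)
    have e2 := card_union_le (image f univ) ((image g univ).erase w)
    have e3 : ((image g univ).erase w).card = (image g univ).card - 1 :=
      card_erase_of_mem (mem_image.mpr ⟨q, mem_univ _, gq⟩)
    have e4 : (univ.biUnion C).card ≤ (univ : Finset (Fin k)).card * k :=
      card_biUnion_le_card_mul _ _ _ (fun i _ => hC2 i)
    rw [card_univ, Fintype.card_fin] at e4
    rw [← hS] at e1
    have e6 : 0 < (image g univ).card := card_pos.mpr ⟨w, mem_image.mpr ⟨q, mem_univ _, gq⟩⟩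
    have e5 : k * (k + 2) = k * k + 2 * k := by ring
    omega
  · convert t1 using 1
    ext a
    simp only [hS, mem_insert, mem_union, mem_image, mem_univ, true_and, mem_erase, mem_biUnion]
    constructor
    · rintro (rfl | ((h | ⟨h0, i, rfl⟩) | ⟨i, hi⟩))
      · right; exact ⟨r, Or.inl yr.symm⟩
      · left; exact h
      · right
        have hiq : i ≠ q := fun e => h0 (by rw [e, gq])
        by_cases h2 : i = r
        · exact ⟨q, Or.inl (by rw [yq, h2])⟩
        · exact ⟨i, Or.inl (yi i hiq h2).symm⟩
      · right; exact ⟨i, Or.inr hi⟩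
    · rintro (h | ⟨i, (h | h)⟩)
      · right; left; left; exact h
      · by_cases h1 : i = q
        · rw [h1, yq] at h
          right; left; right
          exact ⟨fun e => hqr (hwg r (h.symm.trans e)).symm, r, h.symm⟩
        · by_cases h2 : i = r
          · left; rw [h, h2, yr]
          · rw [yi i h1 h2] at h
            right; left; right
            exact ⟨fun e => h1 (hwg i (h.symm.trans e)), i, h.symm⟩
      · right; right; exact ⟨i, h⟩
  · convert t2 using 1
    ext a
    simp only [hS, mem_insert, mem_union, mem_image, mem_univ, true_and, mem_erase, mem_biUnion]
    constructor
    · rintro (rfl | ((⟨i, rfl⟩ | ⟨h0, h⟩) | ⟨i, hi⟩))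
      · right; exact ⟨q, Or.inl zq.symm⟩
      · by_cases h1 : i = q
        · left; exact ⟨q, by rw [gq, h1, fq]⟩
        · right; exact ⟨i, Or.inl (zi i h1).symm⟩
      · left; exact h
      · right; exact ⟨i, Or.inr hi⟩
    · rintro (⟨i, rfl⟩ | ⟨i, (h | h)⟩)
      · right; left
        by_cases h1 : i = q
        · left; exact ⟨q, by rw [fq, h1, gq]⟩
        · right; exact ⟨fun e => h1 (hwg i e), i, rfl⟩
      · by_cases h1 : i = q
        · left; rw [h, h1, zq]
        · right; left; left; exact ⟨i, by rw [h, zi i h1]⟩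
      · right; right; exact ⟨i, h⟩

end RTT

open RTT in
/-- Under a bipartite-hole condition, the whole vertex set is
`(F, βn, t)`-closed. -/
theorem whole_vertex_set_closed :
    ∀ k : ℕ, 3 ≤ k → ∀ F : SimpleGraph (Fin k), ∀ η : ℝ, 0 < η →
    (F.IsTree ∨ (4 ≤ k ∧ F = SimpleGraph.cycleGraph k ∧ 1 / (k : ℝ) ≤ η)) →
    ∀ μ : ℝ, 0 < μ →
    ∃ α β : ℝ, ∃ t : ℕ, 0 < α ∧ 0 < β ∧ ∃ N : ℕ, ∀ n : ℕ, N ≤ n →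
      ∀ G : SimpleGraph (Fin n),
        MinDegGE G ((η + μ) * n) → HoleBound G (α * n) →
        FClosed F G (β * n) t Finset.univ := by
  intro k hk F η hη hF μ hμ
  obtain ⟨q, r, hnice⟩ := nice_of hk F (hF.imp id fun h => ⟨h.1, h.2.1⟩)
  set γ := η ^ 2 / 4 with hγ
  have hγ0 : 0 < γ := by positivity
  have hk0 : (0 : ℝ) < k := by exact_mod_cast (by omega : 0 < k)
  refine ⟨γ / (8 * k), min (γ / 4) (1 / 8), k + 2, by positivity, by positivity,
    ⌈20 * (k : ℝ) ^ 2 / γ⌉₊ + 16, ?_⟩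
  intro n hn G hdeg hhole u _ v _ huv W hW
  have hn16 : (16 : ℝ) ≤ n := by exact_mod_cast (by omega : 16 ≤ n)
  have hnpos : 0 < n := by omega
  have hn0 : (0 : ℝ) < n := by linarith
  have hbig : 20 * (k : ℝ) ^ 2 ≤ γ * n := by
    have h1 : 20 * (k : ℝ) ^ 2 / γ ≤ n :=
      (Nat.le_ceil _).trans (by exact_mod_cast (by omega : ⌈20 * (k : ℝ) ^ 2 / γ⌉₊ ≤ n))
    rw [div_le_iff₀ hγ0] at h1
    linarith
  have : Nonempty (Fin n) := ⟨u⟩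
  have hnb : ∀ x, η * n ≤ ((nb G x).card : ℝ) := by
    intro x
    have := nb_card G _ hdeg x
    have h2 : 0 < μ * n := by positivity
    linarith
  have hW1 : (W.card : ℝ) ≤ γ / 4 * n :=
    hW.trans (mul_le_mul_of_nonneg_right (min_le_left _ _) hn0.le)
  have hW2 : (W.card : ℝ) ≤ 1 / 8 * n :=
    hW.trans (mul_le_mul_of_nonneg_right (min_le_right _ _) hn0.le)
  obtain ⟨w, hw, hX⟩ := exists_q G η hη hnpos hnb (insert u (insert v W)) (by
    have h1 := card_insert_le u (insert v W)
    have h2 := card_insert_le v W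
    have h3 : ((insert u (insert v W)).card : ℝ) ≤ W.card + 2 := by
      exact_mod_cast (by omega : (insert u (insert v W)).card ≤ W.card + 2)
    linarith)
  refine reach_main F G (⌊γ / (8 * k) * n⌋₊ + 1) (by omega) hk ?_ q r hnice (γ * n) u v huv W
    ?_ ?_ w hw hX
  · intro U₁ U₂ hd h1 h2
    by_contra hcon
    push Not at hcon
    have h3 := hhole _ U₁ U₂ hd h1 h2 hcon
    have h4 := Nat.lt_floor_add_one (γ / (8 * k) * n)
    push_cast at h3
    linarith
  · have h1 : ((⌊γ / (8 * k) * n⌋₊ : ℕ) : ℝ) ≤ γ / (8 * k) * n := Nat.floor_le (by positivity)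
    have h2 : (⌊γ / (8 * k) * n⌋₊ : ℝ) * k ≤ γ * n / 8 := by
      calc _ ≤ γ / (8 * k) * n * k := mul_le_mul_of_nonneg_right h1 hk0.le
        _ = _ := by field_simp
    have hk3 : (3 : ℝ) ≤ k := by exact_mod_cast hk
    push_cast
    nlinarith
  · intro x
    have h1 := cl_card G (η * n) (γ * n) (by positivity) (by positivity) hnb x
    have h2 : η * n * (η * n) = 4 * (γ * n) * n := by rw [hγ]; ring
    have h3 : 0 ≤ γ * n * n := by positivity
    have h4 : (γ * n) * n ≤ ((cl G (γ * n) x).card : ℝ) * n := by linarith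
    exact le_of_mul_le_mul_right h4 hn0
end
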